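/- Assume (B0)–(B3), fix ȳ ∈ cl V, let ũ : cl U_ȳ → ℝ be the modified potential of a c-convex function, let Q := {ũ ≤ 0}, fix q̃ ∈ int Q, and assume ũ = 0 on ∂Q and cl Q ⊂ U_ȳ. Let h^{c̃} be the c̃-cone generated by q̃ and Q with height −ũ(q̃) > 0. Then: (a) h^{c̃} has convex level sets, and it is a convex function if in addition (B4) holds; (b) h^{c̃}(q) ≥ h^{c̃}(q̃) = ũ(q̃) for all q ∈ Q; (c) h^{c̃} = 0 on ∂Q; (d) ∂^{c̃} h^{c̃}(q̃) ⊂ ∂^{c̃} ũ(Q). -/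

import Mathlib

open Set MeasureTheory Metric Bornology
open scoped ENNReal NNReal Pointwise

noncomputable section

abbrev Euc (n : ℕ) := EuclideanSpace ℝ (Fin n)

/-- Partial gradient of the cost in the first variable: `D_x c(x,y)`. -/
noncomputable def gradX (n : ℕ) (c : Euc n → Euc n → ℝ) (x y : Euc n) : Euc n :=
  gradient (fun x' => c x' y) x

/-- Partial gradient of the cost in the second variable: `D_y c(x,y)`. -/
noncomputable def gradY (n : ℕ) (c : Euc n → Euc n → ℝ) (x y : Euc n) : Euc n :=
  gradient (fun y' => c x y') y

/-- Mixed second derivative `D²_{xy} c` as a continuous linear map. -/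
noncomputable def DxyC (n : ℕ) (c : Euc n → Euc n → ℝ) (x y : Euc n) : Euc n →L[ℝ] Euc n :=
  fderiv ℝ (fun x' => gradY n c x' y) x

/-- Second derivative `D²_{xx} c`. -/
noncomputable def DxxC (n : ℕ) (c : Euc n → Euc n → ℝ) (x y : Euc n) : Euc n →L[ℝ] Euc n :=
  fderiv ℝ (fun x' => gradX n c x' y) x

/-- Third derivative `D²_{xx} D_y c`. -/
noncomputable def DxxyC (n : ℕ) (c : Euc n → Euc n → ℝ) (x y : Euc n) :
    Euc n →L[ℝ] Euc n →L[ℝ] Euc n :=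
  fderiv ℝ (fun x' => DxyC n c x' y) x

/-- `β⁺_c = ‖D²_{xy} c‖_{L∞(U×V)}`. -/
noncomputable def betaPlus (n : ℕ) (c : Euc n → Euc n → ℝ) (U V : Set (Euc n)) : ℝ :=
  sSup ((fun p : Euc n × Euc n => ‖DxyC n c p.1 p.2‖) '' (U ×ˢ V))

/-- `β⁻_c = ‖(D²_{xy} c)⁻¹‖_{L∞(U×V)}`. -/
noncomputable def betaMinus (n : ℕ) (c : Euc n → Euc n → ℝ) (U V : Set (Euc n)) : ℝ :=
  sSup ((fun p : Euc n × Euc n => ‖(DxyC n c p.1 p.2).inverse‖) '' (U ×ˢ V))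

/-- `γ⁺_c = ‖det D²_{xy} c‖_{L∞(U×V)}`. -/
noncomputable def gammaPlus (n : ℕ) (c : Euc n → Euc n → ℝ) (U V : Set (Euc n)) : ℝ :=
  sSup ((fun p : Euc n × Euc n =>
    |LinearMap.det ((DxyC n c p.1 p.2 : Euc n →L[ℝ] Euc n) : Euc n →ₗ[ℝ] Euc n)|) '' (U ×ˢ V))

/-- `γ⁻_c = ‖(det D²_{xy} c)⁻¹‖_{L∞(U×V)}`. -/
noncomputable def gammaMinus (n : ℕ) (c : Euc n → Euc n → ℝ) (U V : Set (Euc n)) : ℝ :=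
  sSup ((fun p : Euc n × Euc n =>
    |LinearMap.det ((DxyC n c p.1 p.2 : Euc n →L[ℝ] Euc n) : Euc n →ₗ[ℝ] Euc n)|⁻¹) '' (U ×ˢ V))

noncomputable def supDxx (n : ℕ) (c : Euc n → Euc n → ℝ) (U V : Set (Euc n)) : ℝ :=
  sSup ((fun p : Euc n × Euc n => ‖DxxC n c p.1 p.2‖) '' (U ×ˢ V))

noncomputable def supDx (n : ℕ) (c : Euc n → Euc n → ℝ) (U V : Set (Euc n)) : ℝ :=
  sSup ((fun p : Euc n × Euc n => ‖gradX n c p.1 p.2‖) '' (U ×ˢ V))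

noncomputable def supDxxy (n : ℕ) (c : Euc n → Euc n → ℝ) (U V : Set (Euc n)) : ℝ :=
  sSup ((fun p : Euc n × Euc n => ‖DxxyC n c p.1 p.2‖) '' (U ×ˢ V))

/-- The constant `M_c` from Theorem 4.3. -/
noncomputable def Mconst (n : ℕ) (c : Euc n → Euc n → ℝ) (U V : Set (Euc n)) : ℝ :=
  (betaMinus n c U V) ^ 2 * supDxx n c U V +
    (betaMinus n c U V) ^ 3 * supDx n c U V * supDxxy n c U V

/-- The constant `ε_c` of Lemma 6.1: `1/ε_c = 2 (β⁺)⁴ (β⁻)⁶ ‖D³_{xxy} c‖_∞`. -/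
noncomputable def epsC (n : ℕ) (c : Euc n → Euc n → ℝ) (U V : Set (Euc n)) : ℝ :=
  (2 * (betaPlus n c U V) ^ 4 * (betaMinus n c U V) ^ 6 * supDxxy n c U V)⁻¹

/-- Condition (B0). -/
def B0cond (n : ℕ) (c : Euc n → Euc n → ℝ) (U V : Set (Euc n)) : Prop :=
  IsOpen U ∧ IsBounded U ∧ IsOpen V ∧ IsBounded V ∧
    ContDiffOn ℝ 4 (Function.uncurry c) (closure U ×ˢ closure V)

/-- `f` is a (C¹-) diffeomorphism from `S` onto its range. -/
def DiffeoOnto (n : ℕ) (f : Euc n → Euc n) (S : Set (Euc n)) : Prop :=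
  Set.InjOn f S ∧ ContDiffOn ℝ 1 f S ∧ ContDiffOn ℝ 1 (Function.invFunOn f S) (f '' S)

/-- Condition (B1) (bi-twist). -/
def B1cond (n : ℕ) (c : Euc n → Euc n → ℝ) (U V : Set (Euc n)) : Prop :=
  (∀ y ∈ closure V, DiffeoOnto n (fun x => -gradY n c x y) (closure U)) ∧
  (∀ x ∈ closure U, DiffeoOnto n (fun y => -gradX n c x y) (closure V))

/-- `U_ȳ := -D_y c(U, ȳ)`. -/
def Uyset (n : ℕ) (c : Euc n → Euc n → ℝ) (U : Set (Euc n)) (ybar : Euc n) : Set (Euc n) :=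
  (fun x => -gradY n c x ybar) '' U

/-- `V_x̄ := -D_x c(x̄, V)`. -/
def Vxset (n : ℕ) (c : Euc n → Euc n → ℝ) (V : Set (Euc n)) (xbar : Euc n) : Set (Euc n) :=
  (fun y => -gradX n c xbar y) '' V

/-- Condition (B2) (bi-convexity). -/
def B2cond (n : ℕ) (c : Euc n → Euc n → ℝ) (U V : Set (Euc n)) : Prop :=
  (∀ y ∈ closure V, Convex ℝ (Uyset n c U y)) ∧ (∀ x ∈ closure U, Convex ℝ (Vxset n c V x))

/-- A strongly convex set: each boundary point is touched from outside by a sphere of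
radius `R` enclosing the set. -/
def StronglyConvexSet (n : ℕ) (Q : Set (Euc n)) : Prop :=
  Convex ℝ Q ∧ ∃ R : ℝ, 0 < R ∧ ∀ x ∈ frontier Q, ∃ z : Euc n, dist x z = R ∧ Q ⊆ closedBall z R

/-- Condition (B2s). -/
def B2scond (n : ℕ) (c : Euc n → Euc n → ℝ) (U V : Set (Euc n)) : Prop :=
  (∀ y ∈ closure V, StronglyConvexSet n (Uyset n c U y)) ∧
  (∀ x ∈ closure U, StronglyConvexSet n (Vxset n c V x))

/-- An affinely parameterized line segment on `[-1,1]`. -/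
def IsAffineSeg (n : ℕ) (F : ℝ → Euc n × Euc n) : Prop :=
  ∃ a b : Euc n × Euc n, ∀ t ∈ Icc (-1 : ℝ) 1, F t = a + t • b

/-- `∂²/∂s∂t c(x(s), y(t))` at `(0,0)`. -/
noncomputable def crossDiff2 (n : ℕ) (c : Euc n → Euc n → ℝ) (x y : ℝ → Euc n) : ℝ :=
  deriv (fun s => deriv (fun t => c (x s) (y t)) 0) 0

/-- `∂⁴/∂s²∂t² c(x(s), y(t))` at `(0,0)`. -/
noncomputable def crossDiff4 (n : ℕ) (c : Euc n → Euc n → ℝ) (x y : ℝ → Euc n) : ℝ :=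
  deriv (deriv (fun s => deriv (deriv (fun t => c (x s) (y t))) 0)) 0

/-- Condition (B3) (= A3w). -/
def B3cond (n : ℕ) (c : Euc n → Euc n → ℝ) (U V : Set (Euc n)) : Prop :=
  ∀ x y : ℝ → Euc n, (∀ t ∈ Icc (-1 : ℝ) 1, x t ∈ closure U) →
    (∀ t ∈ Icc (-1 : ℝ) 1, y t ∈ closure V) →
    IsAffineSeg n (fun t => (gradY n c (x t) (y 0), gradX n c (x 0) (y t))) →
    crossDiff2 n c x y = 0 → crossDiff4 n c x y ≤ 0

/-- Condition (B4) (non-negative cross-curvature). -/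
def B4cond (n : ℕ) (c : Euc n → Euc n → ℝ) (U V : Set (Euc n)) : Prop :=
  ∀ x y : ℝ → Euc n, (∀ t ∈ Icc (-1 : ℝ) 1, x t ∈ closure U) →
    (∀ t ∈ Icc (-1 : ℝ) 1, y t ∈ closure V) →
    IsAffineSeg n (fun t => (gradY n c (x t) (y 0), gradX n c (x 0) (y t))) →
    crossDiff4 n c x y ≤ 0

/-- The `c*`-transform `u^{c*}(y) = sup_{x ∈ A} (-c(x,y) - u(x))`. -/
noncomputable def cStarT (n : ℕ) (c : Euc n → Euc n → ℝ) (A : Set (Euc n)) (u : Euc n → ℝ)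
    (y : Euc n) : ℝ :=
  sSup ((fun x => -c x y - u x) '' A)

/-- `u` is `c`-convex on `A` (relative to the target set `B`): `u = (u^{c*})^c`. -/
def CConvexOn (n : ℕ) (c : Euc n → Euc n → ℝ) (A B : Set (Euc n)) (u : Euc n → ℝ) : Prop :=
  ∀ x ∈ A, u x = sSup ((fun y => -c x y - cStarT n c A u y) '' B)

/-- The `c`-subdifferential `∂ᶜu ⊂ A × B`. -/
def cSubdiff (n : ℕ) (c : Euc n → Euc n → ℝ) (A B : Set (Euc n)) (u : Euc n → ℝ) :
    Set (Euc n × Euc n) :=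
  {p | p.1 ∈ A ∧ p.2 ∈ B ∧ u p.1 + cStarT n c A u p.2 + c p.1 p.2 = 0}

def cSubdiffAt (n : ℕ) (c : Euc n → Euc n → ℝ) (A B : Set (Euc n)) (u : Euc n → ℝ)
    (x : Euc n) : Set (Euc n) :=
  {y | (x, y) ∈ cSubdiff n c A B u}

def cSubdiffImg (n : ℕ) (c : Euc n → Euc n → ℝ) (A B : Set (Euc n)) (u : Euc n → ℝ)
    (X : Set (Euc n)) : Set (Euc n) :=
  ⋃ x ∈ X, cSubdiffAt n c A B u x

/-- `∂^{c*}u^{c*}(Y) = {x : ∃ y ∈ Y, (x,y) ∈ ∂ᶜu}`. -/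
def cSubdiffPre (n : ℕ) (c : Euc n → Euc n → ℝ) (A B : Set (Euc n)) (u : Euc n → ℝ)
    (Y : Set (Euc n)) : Set (Euc n) :=
  {x | ∃ y ∈ Y, (x, y) ∈ cSubdiff n c A B u}

/-- `|∂ᶜu| ≥ lam` on `S`. -/
def MAge (n : ℕ) (c : Euc n → Euc n → ℝ) (A B : Set (Euc n)) (u : Euc n → ℝ) (lam : ℝ)
    (S : Set (Euc n)) : Prop :=
  ∀ X : Set (Euc n), X ⊆ S → MeasurableSet X →
    ENNReal.ofReal lam * volume X ≤ volume (cSubdiffImg n c A B u X)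

/-- `|∂ᶜu| ≤ lam` on `S`. -/
def MAle (n : ℕ) (c : Euc n → Euc n → ℝ) (A B : Set (Euc n)) (u : Euc n → ℝ) (lam : ℝ)
    (S : Set (Euc n)) : Prop :=
  ∀ X : Set (Euc n), X ⊆ S → MeasurableSet X →
    volume (cSubdiffImg n c A B u X) ≤ ENNReal.ofReal lam * volume X

/-- The inverse of the cost-exponential coordinate change `q(x) = -D_y c(x, ȳ)`. -/
noncomputable def xOf (n : ℕ) (c : Euc n → Euc n → ℝ) (U : Set (Euc n)) (ybar : Euc n) :
    Euc n → Euc n :=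
  Function.invFunOn (fun x => -gradY n c x ybar) (closure U)

/-- `cl U_ȳ := -D_y c(cl U, ȳ)`. -/
def clUy (n : ℕ) (c : Euc n → Euc n → ℝ) (U : Set (Euc n)) (ybar : Euc n) : Set (Euc n) :=
  (fun x => -gradY n c x ybar) '' closure U

/-- The modified cost `c̃(q,y) = c(x(q), y) - c(x(q), ȳ)`. -/
noncomputable def modCost (n : ℕ) (c : Euc n → Euc n → ℝ) (U : Set (Euc n)) (ybar : Euc n)
    (q y : Euc n) : ℝ :=
  c (xOf n c U ybar q) y - c (xOf n c U ybar q) ybar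

/-- The modified potential `ũ(q) = u(x(q)) + c(x(q), ȳ)`. -/
noncomputable def modPot (n : ℕ) (c : Euc n → Euc n → ℝ) (U : Set (Euc n)) (ybar : Euc n)
    (u : Euc n → ℝ) (q : Euc n) : ℝ :=
  u (xOf n c U ybar q) + c (xOf n c U ybar q) ybar

/-- The `c̃`-cone generated by `qt` and `Q` with height `-h0 > 0`. -/
noncomputable def cConeFun (n : ℕ) (ct : Euc n → Euc n → ℝ) (B Q : Set (Euc n)) (qt : Euc n)
    (h0 : ℝ) (q : Euc n) : ℝ :=
  sSup {r : ℝ | ∃ y ∈ B, r = -ct q y + ct qt y + h0 ∧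
    ∀ p ∈ frontier Q, -ct p y + ct qt y + h0 ≤ 0}

/-- The ordinary subdifferential `∂u(x)` relative to a domain `A`. -/
def subdiffAt (n : ℕ) (A : Set (Euc n)) (u : Euc n → ℝ) (x : Euc n) : Set (Euc n) :=
  {p | ∀ ε > 0, ∃ δ > 0, ∀ x' ∈ A, ‖x' - x‖ < δ →
    u x + @inner ℝ _ _ p (x' - x) - ε * ‖x' - x‖ ≤ u x'}

/-- The dual norm `‖v‖*_K = sup_{w ∈ K} ⟨w, v⟩`. -/
noncomputable def dualNorm (n : ℕ) (K : Set (Euc n)) (v : Euc n) : ℝ :=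
  sSup ((fun w => (@inner ℝ _ _ w v : ℝ)) '' K)

/-- The section `S(x̄, ȳ, τ)`. -/
def sectS (n : ℕ) (c : Euc n → Euc n → ℝ) (U : Set (Euc n)) (u : Euc n → ℝ)
    (xbar ybar : Euc n) (τ : ℝ) : Set (Euc n) :=
  {x ∈ U | u x ≤ u xbar - c x ybar + c xbar ybar + τ}

/-- The measure with density `f` restricted to `A`. -/
noncomputable def densMeasure (n : ℕ) (A : Set (Euc n)) (f : Euc n → ℝ) : Measure (Euc n) :=
  (volume.restrict A).withDensity fun x => ENNReal.ofReal (f x)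

end

section Helpers
open Filter Topology

section generic
variable {W : Type*} [NormedAddCommGroup W] [NormedSpace ℝ W]

/-- directional derivative -/
noncomputable def dd (v : W) (F : W → ℝ) : W → ℝ := fun z => fderiv ℝ F z v

/-- second order operator along a 2-jet -/
noncomputable def LL (v a : W) (F : W → ℝ) : W → ℝ := fun z => dd v (dd v F) z + dd a F z

lemma dd_contDiffOn {O : Set W} (hO : IsOpen O) {F : W → ℝ} (k : ℕ) {m : ℕ} (hm : m = k + 1)
    (hF : ContDiffOn ℝ m F O) (v : W) : ContDiffOn ℝ k (dd v F) O := by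
  subst hm
  have := hF.fderiv_of_isOpen hO (m := k) (by norm_cast)
  exact this.clm_apply contDiffOn_const

lemma LL_contDiffOn {O : Set W} (hO : IsOpen O) {F : W → ℝ} (k : ℕ) {m : ℕ} (hm : m = k + 2)
    (hF : ContDiffOn ℝ m F O) (v a : W) : ContDiffOn ℝ k (LL v a F) O := by
  have h1 := dd_contDiffOn hO (k+1) (by omega) hF
  have h2 := dd_contDiffOn hO k rfl (h1 v) v
  exact h2.add ((h1 a).of_le (by norm_cast; omega))

lemma dd_congr {O : Set W} (hO : IsOpen O) {F G : W → ℝ} (h : EqOn F G O) (v : W) :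
    EqOn (dd v F) (dd v G) O := by
  intro z hz
  have : F =ᶠ[𝓝 z] G := h.eventuallyEq_of_mem (hO.mem_nhds hz)
  simp [dd, this.fderiv_eq]

lemma LL_congr {O : Set W} (hO : IsOpen O) {F G : W → ℝ} (h : EqOn F G O) (v a : W) :
    EqOn (LL v a F) (LL v a G) O := by
  intro z hz
  simp only [LL]
  rw [dd_congr hO (dd_congr hO h v) v hz, dd_congr hO h a hz]

lemma diffAt_of {O : Set W} (hO : IsOpen O) {F : W → ℝ} {m : ℕ} (hm : 1 ≤ m)
    (hF : ContDiffOn ℝ m F O) {z : W} (hz : z ∈ O) : DifferentiableAt ℝ F z :=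
  (hF.contDiffAt (hO.mem_nhds hz)).differentiableAt (by norm_cast; omega)

lemma dd_add {O : Set W} (hO : IsOpen O) {F G : W → ℝ} {m : ℕ} (hm : 1 ≤ m)
    (hF : ContDiffOn ℝ m F O) (hG : ContDiffOn ℝ m G O) (v : W) :
    EqOn (dd v (fun z => F z + G z)) (fun z => dd v F z + dd v G z) O := by
  intro z hz
  simp only [dd]
  rw [fderiv_fun_add (diffAt_of hO hm hF hz) (diffAt_of hO hm hG hz)]
  rfl

lemma LL_add {O : Set W} (hO : IsOpen O) {F G : W → ℝ} {m : ℕ} (hm : 2 ≤ m)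
    (hF : ContDiffOn ℝ m F O) (hG : ContDiffOn ℝ m G O) (v a : W) :
    EqOn (LL v a (fun z => F z + G z)) (fun z => LL v a F z + LL v a G z) O := by
  intro z hz
  simp only [LL]
  obtain ⟨k, rfl⟩ : ∃ k, m = (k + 1) + 1 := ⟨m - 2, by omega⟩
  rw [dd_congr hO (dd_add hO (by omega) hF hG v) v hz,
    dd_add hO (m := k+1) (by omega) (dd_contDiffOn hO (k+1) rfl hF v)
      (dd_contDiffOn hO (k+1) rfl hG v) v hz,
    dd_add hO (by omega) hF hG a hz]
  ring

lemma dd_dd {O : Set W} (hO : IsOpen O) {F : W → ℝ} {m : ℕ} (hm : 2 ≤ m)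
    (hF : ContDiffOn ℝ m F O) (v w : W) {z : W} (hz : z ∈ O) :
    dd v (dd w F) z = fderiv ℝ (fderiv ℝ F) z v w := by
  have h1 : ContDiffOn ℝ 1 (fderiv ℝ F) O :=
    hF.fderiv_of_isOpen hO (m := 1) (by norm_cast)
  have h2 : DifferentiableAt ℝ (fderiv ℝ F) z :=
    (h1.contDiffAt (hO.mem_nhds hz)).differentiableAt (by norm_num)
  change fderiv ℝ (fun z => fderiv ℝ F z w) z v = _
  rw [fderiv_clm_apply h2 (differentiableAt_const _)]
  simp

lemma dd_comm {O : Set W} (hO : IsOpen O) {F : W → ℝ} {m : ℕ} (hm : 2 ≤ m)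
    (hF : ContDiffOn ℝ m F O) (v w : W) : EqOn (dd v (dd w F)) (dd w (dd v F)) O := by
  intro z hz
  rw [dd_dd hO hm hF v w hz, dd_dd hO hm hF w v hz]
  have h := (hF.contDiffAt (hO.mem_nhds hz)).isSymmSndFDerivAt (by
    simp only [minSmoothness_of_isRCLikeNormedField]; norm_cast)
  exact h v w

lemma LL_dd_comm {O : Set W} (hO : IsOpen O) {F : W → ℝ} {m : ℕ} (hm : 3 ≤ m)
    (hF : ContDiffOn ℝ m F O) (v a w : W) : EqOn (LL v a (dd w F)) (dd w (LL v a F)) O := by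
  intro z hz
  obtain ⟨k, rfl⟩ : ∃ k, m = (k + 2) + 1 := ⟨m - 3, by omega⟩
  have h1 := fun v => dd_contDiffOn hO (k+2) rfl hF v
  have h2 := fun v w => dd_contDiffOn hO (k+1) rfl (h1 v) w
  have e1 : dd w (LL v a F) z = dd w (dd v (dd v F)) z + dd w (dd a F) z :=
    dd_add hO (m := k+1) (by omega) (h2 v v) ((h1 a).of_le (by norm_cast; omega)) w hz
  rw [e1, dd_comm hO (by omega) (h1 v) w v hz, dd_congr hO (dd_comm hO (by omega) hF w v) v hz,
    dd_comm hO (by omega) hF w a hz]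
  rfl

lemma LL_comm {O : Set W} (hO : IsOpen O) {F : W → ℝ}
    (hF : ContDiffOn ℝ 4 F O) (v a w b : W) : EqOn (LL v a (LL w b F)) (LL w b (LL v a F)) O := by
  intro z hz
  have hF' : ContDiffOn ℝ ((4:ℕ)) F O := hF
  have h1 := fun v => dd_contDiffOn hO 3 rfl hF' v
  have h2 := fun v w => dd_contDiffOn hO 2 rfl (h1 v) w
  have e1 : LL v a (LL w b F) z = LL v a (dd w (dd w F)) z + LL v a (dd b F) z :=
    LL_add hO (m := 2) (by omega) (h2 w w) ((h1 b).of_le (by norm_cast)) v a hz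
  rw [e1, LL_dd_comm hO (by omega) (h1 w) v a w hz,
    dd_congr hO (LL_dd_comm hO (by omega) hF' v a w) w hz,
    LL_dd_comm hO (by omega) hF' v a b hz]
  rfl

lemma dd_smul (r : ℝ) (v : W) (F : W → ℝ) (z : W) : dd (r • v) F z = r * dd v F z := by
  simp [dd]

/-- chain rule, first order -/
lemma hasDerivAt_comp_curve {O : Set W} (hO : IsOpen O) {F : W → ℝ} {m : ℕ} (hm : 1 ≤ m)
    (hF : ContDiffOn ℝ m F O) {γ : ℝ → W} {t : ℝ} (hγ : DifferentiableAt ℝ γ t) (ht : γ t ∈ O) :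
    HasDerivAt (fun s => F (γ s)) (dd (deriv γ t) F (γ t)) t :=
  (diffAt_of hO hm hF ht).hasFDerivAt.comp_hasDerivAt t hγ.hasDerivAt

lemma hasDerivAt_comp_curve2 {O : Set W} (hO : IsOpen O) {F : W → ℝ} {m : ℕ} (hm : 2 ≤ m)
    (hF : ContDiffOn ℝ m F O) {γ : ℝ → W} {t : ℝ} (hγ : ContDiffAt ℝ 2 γ t) (ht : γ t ∈ O) :
    HasDerivAt (fun s => dd (deriv γ s) F (γ s))
      (LL (deriv γ t) (deriv (deriv γ) t) F (γ t)) t := by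
  have h1 : ContDiffOn ℝ 1 (fderiv ℝ F) O :=
    hF.fderiv_of_isOpen hO (m := 1) (by norm_cast)
  have h2 : DifferentiableAt ℝ (fderiv ℝ F) (γ t) :=
    (h1.contDiffAt (hO.mem_nhds ht)).differentiableAt (by norm_num)
  have h3 : DifferentiableAt ℝ γ t := hγ.differentiableAt (by norm_num)
  have h4 : DifferentiableAt ℝ (deriv γ) t := by
    have : ContDiffAt ℝ 1 (fderiv ℝ γ) t := hγ.fderiv_right (by norm_num)
    have := this.differentiableAt (by norm_num)
    have h5 := this.clm_apply (differentiableAt_const (1:ℝ))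
    exact h5
  have h5 := (h2.hasFDerivAt.comp_hasDerivAt t h3.hasDerivAt).clm_apply h4.hasDerivAt
  refine HasDerivAt.congr_deriv h5 ?_
  simp only [LL]
  rw [dd_dd hO hm hF _ _ ht]
  rfl

lemma deriv2_comp_curve {O : Set W} (hO : IsOpen O) {F : W → ℝ} {m : ℕ} (hm : 2 ≤ m)
    (hF : ContDiffOn ℝ m F O) {γ : ℝ → W} {t : ℝ} (hγ : ContDiffAt ℝ 2 γ t) (ht : γ t ∈ O) :
    deriv (deriv (fun s => F (γ s))) t = LL (deriv γ t) (deriv (deriv γ) t) F (γ t) := by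
  rw [← (hasDerivAt_comp_curve2 hO hm hF hγ ht).deriv]
  apply Filter.EventuallyEq.deriv_eq
  have e1 : ∀ᶠ s in 𝓝 t, γ s ∈ O := hγ.continuousAt.preimage_mem_nhds (hO.mem_nhds ht)
  have e2 : ∀ᶠ s in 𝓝 t, ContDiffAt ℝ 2 γ s := hγ.eventually (by norm_num)
  filter_upwards [e1, e2] with s h1 h2
  exact (hasDerivAt_comp_curve hO (by omega) hF (h2.differentiableAt (by norm_num)) h1).deriv

end generic

lemma B0flip {n : ℕ} {c : Euc n → Euc n → ℝ} {U V : Set (Euc n)} (h : B0cond n c U V) :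
    B0cond n (fun y x => c x y) V U := by
  obtain ⟨h1, h2, h3, h4, h5⟩ := h
  refine ⟨h3, h4, h1, h2, ?_⟩
  have : ContDiffOn ℝ 4 (Prod.swap : Euc n × Euc n → Euc n × Euc n) (closure V ×ˢ closure U) :=
    (contDiff_snd.prodMk contDiff_fst).contDiffOn
  exact h5.comp this (fun z hz => ⟨hz.2, hz.1⟩)

lemma B1flip {n : ℕ} {c : Euc n → Euc n → ℝ} {U V : Set (Euc n)} (h : B1cond n c U V) :
    B1cond n (fun y x => c x y) V U := ⟨h.2, h.1⟩

lemma B2flip {n : ℕ} {c : Euc n → Euc n → ℝ} {U V : Set (Euc n)} (h : B2cond n c U V) :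
    B2cond n (fun y x => c x y) V U := ⟨h.2, h.1⟩

lemma equiv_of_inj {n : ℕ} (A : Euc n →L[ℝ] Euc n) (h : Function.Injective A) :
    ∃ e : Euc n ≃L[ℝ] Euc n, (e : Euc n →L[ℝ] Euc n) = A := by
  refine ⟨(LinearEquiv.ofInjectiveEndo (A : Euc n →ₗ[ℝ] Euc n) h).toContinuousLinearEquiv, ?_⟩
  ext1 x
  simp

lemma invFunOn_apply {n : ℕ} {f : Euc n → Euc n} {S : Set (Euc n)} (h : InjOn f S) {y : Euc n}
    (hy : y ∈ S) : Function.invFunOn f S (f y) = y :=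
  h.leftInvOn_invFunOn hy

lemma diffeo_deriv {n : ℕ} {f : Euc n → Euc n} {V : Set (Euc n)} (hV : IsOpen V)
    (hf : DiffeoOnto n f (closure V)) {y : Euc n} (hy : y ∈ V) :
    ∃ e : Euc n ≃L[ℝ] Euc n, HasStrictFDerivAt f (e : Euc n →L[ℝ] Euc n) y := by
  obtain ⟨h1, h2, h3⟩ := hf
  have hy' := subset_closure hy
  have hn : closure V ∈ 𝓝 y := mem_of_superset (hV.mem_nhds hy) subset_closure
  have hs : HasStrictFDerivAt f (fderiv ℝ f y) y :=
    (h2.contDiffAt hn).hasStrictFDerivAt (by norm_num)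
  have hg := ((h3 (f y) ⟨y, hy', rfl⟩).differentiableWithinAt (by norm_num)).hasFDerivWithinAt
  have hc := (hg.comp y hs.hasFDerivAt.hasFDerivWithinAt (mapsTo_image f (closure V)))
  have hc2 := hc.hasFDerivAt hn
  have hid : (Function.invFunOn f (closure V) ∘ f) =ᶠ[𝓝 y] id := by
    filter_upwards [hn] with z hz
    exact invFunOn_apply h1 hz
  have hc3 := hid.symm.hasFDerivAt_iff.2 hc2 |>.unique (hasFDerivAt_id y)
  have hinj : Function.Injective (fderiv ℝ f y) := by
    intro a b hab
    have ha := congrArg (fun A : Euc n →L[ℝ] Euc n => A a) hc3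
    have hb := congrArg (fun A : Euc n →L[ℝ] Euc n => A b) hc3
    simp only [ContinuousLinearMap.comp_apply, ContinuousLinearMap.id_apply] at ha hb
    rw [← ha, ← hb, hab]
  obtain ⟨e, he⟩ := equiv_of_inj _ hinj
  exact ⟨e, he ▸ hs⟩

lemma diffeo_open {n : ℕ} {f : Euc n → Euc n} {V : Set (Euc n)} (hV : IsOpen V)
    (hf : DiffeoOnto n f (closure V)) : IsOpen (f '' V) := by
  rw [isOpen_iff_mem_nhds]
  rintro _ ⟨y, hy, rfl⟩
  obtain ⟨e, he⟩ := diffeo_deriv hV hf hy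
  rw [← he.map_nhds_eq_of_equiv]
  exact image_mem_map (hV.mem_nhds hy)

lemma diffeo_closure {n : ℕ} {f : Euc n → Euc n} {V : Set (Euc n)} (hb : IsBounded V)
    (hf : DiffeoOnto n f (closure V)) : f '' closure V = closure (f '' V) := by
  have hc := hf.2.1.continuousOn
  apply subset_antisymm hc.image_closure
  apply closure_minimal (image_mono subset_closure)
  exact (hb.isCompact_closure.image_of_continuousOn hc).isClosed

lemma diffeo_uniqueDiff {n : ℕ} {f : Euc n → Euc n} {V : Set (Euc n)} (hV : IsOpen V)
    (hb : IsBounded V) (hf : DiffeoOnto n f (closure V)) (hconv : Convex ℝ (f '' V)) :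
    UniqueDiffOn ℝ (closure V) := by
  rcases V.eq_empty_or_nonempty with rfl | ⟨y0, hy0⟩
  · simp [uniqueDiffOn_empty]
  have hU : UniqueDiffOn ℝ (f '' closure V) := by
    rw [diffeo_closure hb hf]
    apply uniqueDiffOn_convex hconv.closure
    refine ⟨f y0, ?_⟩
    exact interior_mono subset_closure ((diffeo_open hV hf).interior_eq.symm ▸ ⟨y0, hy0, rfl⟩)
  obtain ⟨h1, h2, h3⟩ := hf
  intro y hy
  set g := Function.invFunOn f (closure V) with hgdef
  have hgy : g (f y) = y := invFunOn_apply h1 hy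
  have hf' := ((h2 y hy).differentiableWithinAt (by norm_num)).hasFDerivWithinAt
  have hg' := ((h3 (f y) ⟨y, hy, rfl⟩).differentiableWithinAt (by norm_num)).hasFDerivWithinAt
  rw [← hgy] at hf'
  have hmaps : MapsTo g (f '' closure V) (closure V) := by
    rintro _ ⟨z, hz, rfl⟩
    rw [hgdef, invFunOn_apply h1 hz]; exact hz
  have hc := hf'.comp (f y) hg' hmaps
  have hid : HasFDerivWithinAt (f ∘ g) (ContinuousLinearMap.id ℝ (Euc n)) (f '' closure V) (f y) := by
    refine (hasFDerivWithinAt_id _ _).congr ?_ ?_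
    · rintro _ ⟨z, hz, rfl⟩
      simp only [Function.comp, hgdef, invFunOn_apply h1 hz, id]
    · simp [hgy]
  have heq := (hU (f y) ⟨y, hy, rfl⟩).eq hc hid
  have hinj : Function.Injective (fderivWithin ℝ g (f '' closure V) (f y)) := by
    intro a b hab
    have ha := congrArg (fun A : Euc n →L[ℝ] Euc n => A a) heq
    have hb := congrArg (fun A : Euc n →L[ℝ] Euc n => A b) heq
    simp only [ContinuousLinearMap.comp_apply, ContinuousLinearMap.id_apply] at ha hb
    rw [← ha, ← hb, hab]
  obtain ⟨e, he⟩ := equiv_of_inj _ hinj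
  have hdr : DenseRange (fderivWithin ℝ g (f '' closure V) (f y)) := by
    rw [← he]; exact e.surjective.denseRange
  have := hg'.uniqueDiffWithinAt (hU (f y) ⟨y, hy, rfl⟩) hdr
  rw [hgy] at this
  have hset : g '' (f '' closure V) = closure V := ?_
  · rwa [hset] at this
  apply subset_antisymm
  rotate_left
  · intro z hz
    exact ⟨f z, ⟨z, hz, rfl⟩, invFunOn_apply h1 hz⟩
  · exact hmaps.image_subset

lemma uniqueDiff_V {n : ℕ} {c : Euc n → Euc n → ℝ} {U V : Set (Euc n)} (h0 : B0cond n c U V)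
    (h1 : B1cond n c U V) (h2 : B2cond n c U V) (hU : U.Nonempty) :
    UniqueDiffOn ℝ (closure V) := by
  obtain ⟨x, hx⟩ := hU
  exact diffeo_uniqueDiff h0.2.2.1 h0.2.2.2.1 (h1.2 x (subset_closure hx))
    (h2.2 x (subset_closure hx))

lemma uniqueDiff_U {n : ℕ} {c : Euc n → Euc n → ℝ} {U V : Set (Euc n)} (h0 : B0cond n c U V)
    (h1 : B1cond n c U V) (h2 : B2cond n c U V) (hV : V.Nonempty) :
    UniqueDiffOn ℝ (closure U) :=
  uniqueDiff_V (B0flip h0) (B1flip h1) (B2flip h2) hV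

/-- joint continuity of `D_y c` up to the boundary -/
lemma contGY {n : ℕ} {c : Euc n → Euc n → ℝ} {U V : Set (Euc n)} (h0 : B0cond n c U V)
    (h1 : B1cond n c U V) (h2 : B2cond n c U V) (hU : U.Nonempty) (hV : V.Nonempty) :
    ContinuousOn (fun z : Euc n × Euc n => gradY n c z.1 z.2) (closure U ×ˢ closure V) := by
  have uV := uniqueDiff_V h0 h1 h2 hU
  have uU := uniqueDiff_U h0 h1 h2 hV
  obtain ⟨oU, bU, oV, bV, hC⟩ := h0
  have uP := uU.prod uV
  set A : Euc n × Euc n → (Euc n × Euc n →L[ℝ] ℝ) :=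
    fderivWithin ℝ (Function.uncurry c) (closure U ×ˢ closure V) with hA
  have hAc : ContinuousOn A (closure U ×ˢ closure V) :=
    hC.continuousOn_fderivWithin uP (by norm_num)
  set Wf : Euc n × Euc n → Euc n := fun z =>
    (InnerProductSpace.toDual ℝ (Euc n)).symm ((A z).comp (ContinuousLinearMap.inr ℝ (Euc n) (Euc n)))
    with hW
  have hWc : ContinuousOn Wf (closure U ×ˢ closure V) := by
    apply (InnerProductSpace.toDual ℝ (Euc n)).symm.continuous.comp_continuousOn
    exact hAc.clm_comp continuousOn_const
  refine hWc.congr ?_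
  have key : ∀ x ∈ closure U, ∀ y ∈ closure V, DifferentiableAt ℝ (c x) y →
      gradY n c x y = Wf (x, y) := by
    intro x hx y hy hd
    have e1 : fderiv ℝ (c x) y = (A (x, y)).comp (ContinuousLinearMap.inr ℝ (Euc n) (Euc n)) := by
      have hw : HasFDerivWithinAt (Function.uncurry c) (A (x, y)) (closure U ×ˢ closure V) (x, y) :=
        ((hC (x, y) ⟨hx, hy⟩).differentiableWithinAt (by norm_num)).hasFDerivWithinAt
      have hw2 := hw.comp y (hasFDerivAt_prodMk_right x y).hasFDerivWithinAt
        (fun z (hz : z ∈ closure V) => (⟨hx, hz⟩ : (x, z) ∈ closure U ×ˢ closure V))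
      exact (uV y hy).eq hd.hasFDerivAt.hasFDerivWithinAt hw2
    simp only [gradY, gradient, hW]
    rw [← e1]
  rintro ⟨x, y⟩ ⟨hx, hy⟩
  simp only
  by_cases hd : DifferentiableAt ℝ (c x) y
  · exact key x hx y hy hd
  rcases Nat.eq_zero_or_pos n with rfl | hn
  · exact Subsingleton.elim _ _
  have : Nonempty (Fin n) := ⟨⟨0, hn⟩⟩
  have : Nontrivial (Euc n) := inferInstance
  have hz : gradY n c x y = 0 := by
    simp only [gradY, gradient]
    rw [fderiv_zero_of_not_differentiableAt hd]; simp
  obtain ⟨inj, hcd, -⟩ := h1.1 y hy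
  have hne : ∀ x' ∈ closure U \ {x}, gradY n c x' y = Wf (x', y) := by
    intro x' hx'
    apply key x' hx'.1 y hy
    by_contra hd'
    have hz' : gradY n c x' y = 0 := by
      simp only [gradY, gradient]
      rw [fderiv_zero_of_not_differentiableAt hd']; simp
    exact hx'.2 (inj hx'.1 hx (by simp [hz, hz']))
  have hcl : x ∈ closure (closure U \ {x}) := by
    have h3 : U ⊆ closure (U ∩ {x}ᶜ) := (dense_compl_singleton x).open_subset_closure_inter oU
    have h4 : closure U ⊆ closure (U ∩ {x}ᶜ) := closure_minimal h3 isClosed_closure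
    have h5 : U ∩ {x}ᶜ ⊆ closure U \ {x} := fun z hz => ⟨subset_closure hz.1, hz.2⟩
    exact closure_mono h5 (h4 hx)
  have : (𝓝[closure U \ {x}] x).NeBot := mem_closure_iff_nhdsWithin_neBot.1 hcl
  have t1 : Tendsto (fun x' => gradY n c x' y) (𝓝[closure U \ {x}] x) (𝓝 (gradY n c x y)) := by
    have : ContinuousWithinAt (fun x' => gradY n c x' y) (closure U) x := by
      refine (hcd.continuousOn x hx).neg.congr (fun z _ => ?_) ?_ <;> simp
    exact this.tendsto.mono_left (nhdsWithin_mono _ sdiff_subset)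
  have t2 : Tendsto (fun x' => Wf (x', y)) (𝓝[closure U \ {x}] x) (𝓝 (Wf (x, y))) := by
    have : ContinuousOn (fun x' => Wf (x', y)) (closure U) :=
      hWc.comp (by fun_prop) (fun z hz => ⟨hz, hy⟩)
    exact (this x hx).tendsto.mono_left (nhdsWithin_mono _ sdiff_subset)
  refine tendsto_nhds_unique t1 (t2.congr' ?_)
  filter_upwards [self_mem_nhdsWithin] with x' hx'
  exact (hne x' hx').symm

lemma smoothO {n : ℕ} {c : Euc n → Euc n → ℝ} {U V : Set (Euc n)} (h0 : B0cond n c U V) :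
    ContDiffOn ℝ ((4 : ℕ)) (Function.uncurry c) (U ×ˢ V) :=
  h0.2.2.2.2.mono (prod_mono subset_closure subset_closure)

lemma openO {n : ℕ} {c : Euc n → Euc n → ℝ} {U V : Set (Euc n)} (h0 : B0cond n c U V) :
    IsOpen (U ×ˢ V) := h0.1.prod h0.2.2.1

lemma fderiv_right {n : ℕ} {c : Euc n → Euc n → ℝ} {x y : Euc n}
    (hd : DifferentiableAt ℝ (Function.uncurry c) (x, y)) :
    fderiv ℝ (c x) y = (fderiv ℝ (Function.uncurry c) (x, y)).comp
      (ContinuousLinearMap.inr ℝ (Euc n) (Euc n)) :=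
  (hd.hasFDerivAt.comp y (hasFDerivAt_prodMk_right x y)).fderiv

lemma inner_gradY {n : ℕ} {c : Euc n → Euc n → ℝ} {U V : Set (Euc n)} (h0 : B0cond n c U V)
    {x y : Euc n} (hx : x ∈ U) (hy : y ∈ V) (ζ : Euc n) :
    inner ℝ (gradY n c x y) ζ = dd (0, ζ) (Function.uncurry c) (x, y) := by
  simp only [gradY, gradient, dd]
  rw [InnerProductSpace.toDual_symm_apply]
  have := fderiv_right (diffAt_of (openO h0) (by omega) (smoothO h0) (⟨hx, hy⟩ : (x, y) ∈ U ×ˢ V))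
  change fderiv ℝ (c x) y ζ = _
  rw [this]; simp

lemma gradY_smooth {n : ℕ} {c : Euc n → Euc n → ℝ} {U V : Set (Euc n)} (h0 : B0cond n c U V) :
    ContDiffOn ℝ 3 (fun z : Euc n × Euc n => gradY n c z.1 z.2) (U ×ˢ V) := by
  have h1 : ContDiffOn ℝ 3 (fderiv ℝ (Function.uncurry c)) (U ×ˢ V) :=
    (smoothO h0).fderiv_of_isOpen (openO h0) (by norm_cast)
  have h2 : ContDiffOn ℝ 3 (fun z => (InnerProductSpace.toDual ℝ (Euc n)).symm
      ((fderiv ℝ (Function.uncurry c) z).comp (ContinuousLinearMap.inr ℝ (Euc n) (Euc n))))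
      (U ×ˢ V) :=
    (InnerProductSpace.toDual ℝ (Euc n)).symm.contDiff.comp_contDiffOn
      (h1.clm_comp contDiffOn_const)
  refine h2.congr ?_
  rintro ⟨x, y⟩ hz
  simp only [gradY, gradient]
  rw [← fderiv_right (diffAt_of (openO h0) (by omega) (smoothO h0) hz)]

/-- swapping -/
lemma dd_swap {n : ℕ} (F : Euc n × Euc n → ℝ) (v : Euc n × Euc n) :
    dd v (F ∘ Prod.swap) = dd v.swap F ∘ Prod.swap := by
  funext z
  have := (ContinuousLinearEquiv.prodComm ℝ (Euc n) (Euc n)).comp_right_fderiv (f := F) (x := z)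
  have h2 := congrArg (fun A : Euc n × Euc n →L[ℝ] ℝ => A v) this
  exact h2

lemma LL_swap {n : ℕ} (F : Euc n × Euc n → ℝ) (v a : Euc n × Euc n) :
    LL v a (F ∘ Prod.swap) = LL v.swap a.swap F ∘ Prod.swap := by
  funext z
  simp only [LL, dd_swap, Function.comp]

lemma dd_const_mul {W : Type*} [NormedAddCommGroup W] [NormedSpace ℝ W] (r : ℝ) (v : W)
    (F : W → ℝ) : dd v (fun z => r * F z) = fun z => r * dd v F z := by
  funext z
  have : fderiv ℝ (r • F) z = r • fderiv ℝ F z :=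
    congrFun (fderiv_const_smul_field r) z
  have h2 := congrArg (fun A : W →L[ℝ] ℝ => A v) this
  exact h2

lemma LL_const_mul {W : Type*} [NormedAddCommGroup W] [NormedSpace ℝ W] (r : ℝ) (v a : W)
    (F : W → ℝ) : LL v a (fun z => r * F z) = fun z => r * LL v a F z := by
  funext z
  simp only [LL, dd_const_mul]; ring

lemma LL_scale {W : Type*} [NormedAddCommGroup W] [NormedSpace ℝ W] (r : ℝ) (v a : W)
    (F : W → ℝ) : LL (r • v) (r ^ 2 • a) F = fun z => r ^ 2 * LL v a F z := by
  funext z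
  have : dd (r • v) F = fun z => r * dd v F z := by funext z; exact dd_smul r v F z
  simp only [LL, this, dd_smul, dd_const_mul]; ring

/-- coordinates chart -/
lemma chart {n : ℕ} {c : Euc n → Euc n → ℝ} {U V : Set (Euc n)} (h0 : B0cond n c U V)
    (h1 : B1cond n c U V) {y : Euc n} (hy : y ∈ V) {q : Euc n} (hq : q ∈ Uyset n c U y) :
    xOf n c U y q ∈ U ∧ -gradY n c (xOf n c U y q) y = q ∧ ContDiffAt ℝ 3 (xOf n c U y) q := by
  obtain ⟨x, hx, rfl⟩ := hq
  have hd := h1.1 y (subset_closure hy)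
  have e0 : xOf n c U y (-gradY n c x y) = x := invFunOn_apply hd.1 (subset_closure hx)
  refine ⟨?_, by simp only [e0], ?_⟩
  · change xOf n c U y (-gradY n c x y) ∈ U
    rw [e0]; exact hx
  obtain ⟨e, he⟩ := diffeo_deriv h0.1 hd hx
  have hs : ContDiffAt ℝ 3 (fun x => -gradY n c x y) x := by
    have h3 := (gradY_smooth h0).contDiffAt ((openO h0).mem_nhds (⟨hx, hy⟩ : (x, y) ∈ U ×ˢ V))
    exact (h3.comp x (contDiffAt_id.prodMk contDiffAt_const)).neg
  set f : Euc n → Euc n := fun x => -gradY n c x y with hf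
  have hl := hs.to_localInverse he.hasFDerivAt (by norm_num)
  refine hl.congr_of_eventuallyEq ?_
  have hst := hs.hasStrictFDerivAt' he.hasFDerivAt (by norm_num)
  have hr : ∀ᶠ p in 𝓝 (f x), f (hst.localInverse f e x p) = p := hst.eventually_right_inverse
  have hin : ∀ᶠ p in 𝓝 (f x), hst.localInverse f e x p ∈ U := by
    have hc := hst.localInverse_continuousAt
    have hx' : hst.localInverse f e x (f x) = x := hst.localInverse_apply_image
    exact hc.preimage_mem_nhds (h0.1.mem_nhds (hx'.symm ▸ hx))
  filter_upwards [hr, hin] with p hp1 hp2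
  change xOf n c U y p = hst.localInverse f e x p
  conv_lhs => rw [← hp1]
  exact invFunOn_apply hd.1 (subset_closure hp2)

lemma Uy_open {n : ℕ} {c : Euc n → Euc n → ℝ} {U V : Set (Euc n)} (h0 : B0cond n c U V)
    (h1 : B1cond n c U V) {y : Euc n} (hy : y ∈ closure V) : IsOpen (Uyset n c U y) :=
  diffeo_open h0.1 (h1.1 y hy)

lemma mixed {n : ℕ} {c : Euc n → Euc n → ℝ} {U V : Set (Euc n)} (h0 : B0cond n c U V)
    (h1 : B1cond n c U V) {x y : Euc n} (hx : x ∈ U) (hy : y ∈ V) :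
    ∃ e : Euc n ≃L[ℝ] Euc n, HasFDerivAt (fun x => gradY n c x y) (e : Euc n →L[ℝ] Euc n) x ∧
      ∀ ξ ζ, dd (ξ, 0) (dd (0, ζ) (Function.uncurry c)) (x, y) = inner ℝ (e ξ) ζ := by
  obtain ⟨e, he⟩ := diffeo_deriv h0.1 (h1.1 y (subset_closure hy)) hx
  refine ⟨e.trans (ContinuousLinearEquiv.neg ℝ), ?_, ?_⟩
  · have := he.hasFDerivAt.neg
    refine (HasFDerivAt.congr_of_eventuallyEq (f := -fun x => -gradY n c x y) ?_ ?_)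
    · have hE : ((e.trans (ContinuousLinearEquiv.neg ℝ) : Euc n ≃L[ℝ] Euc n) :
          Euc n →L[ℝ] Euc n) = -(e : Euc n →L[ℝ] Euc n) := by
        ext1 v; simp
      rw [hE]; exact this
    · exact Eventually.of_forall fun z => by simp
  · intro ξ ζ
    have hg : HasDerivAt (fun s : ℝ => inner ℝ (gradY n c (x + s • ξ) y) ζ)
        (inner ℝ (-(e ξ)) ζ) 0 := by
      have hl : HasDerivAt (fun s : ℝ => x + s • ξ) ξ 0 := by
        simpa using ((hasDerivAt_id (0:ℝ)).smul_const ξ).const_add x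
      have he' : HasFDerivAt (fun x => -gradY n c x y) (e : Euc n →L[ℝ] Euc n)
        (x + (0:ℝ) • ξ) := by simpa using he.hasFDerivAt
      have h3 := (he'.comp_hasDerivAt (0:ℝ) hl).neg
      have h4 := h3.inner ℝ (hasDerivAt_const (0:ℝ) ζ)
      simpa [Function.comp_def] using h4
    have hline : DifferentiableAt ℝ (fun s : ℝ => (x + s • ξ, y)) 0 := by fun_prop
    have hderiv : deriv (fun s : ℝ => (x + s • ξ, y)) 0 = (ξ, 0) := by
      have hl : HasDerivAt (fun s : ℝ => x + s • ξ) ξ 0 := by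
        simpa using ((hasDerivAt_id (0:ℝ)).smul_const ξ).const_add x
      exact (hl.prodMk (hasDerivAt_const (0:ℝ) y)).deriv
    have hg2 := hasDerivAt_comp_curve (openO h0) (m := 3) (by omega)
      (dd_contDiffOn (openO h0) 3 rfl (smoothO h0) (0, ζ)) (γ := fun s : ℝ => (x + s • ξ, y)) (t := 0)
      hline (by simpa using (⟨hx, hy⟩ : x ∈ U ∧ y ∈ V))
    rw [hderiv] at hg2
    simp only [zero_smul, add_zero] at hg2
    have heq : (fun s : ℝ => inner ℝ (gradY n c (x + s • ξ) y) ζ) =ᶠ[𝓝 0]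
        fun s => dd (0, ζ) (Function.uncurry c) (x + s • ξ, y) := by
      have : ∀ᶠ s : ℝ in 𝓝 0, x + s • ξ ∈ U := by
        have hc : ContinuousAt (fun s : ℝ => x + s • ξ) 0 := by fun_prop
        exact hc.preimage_mem_nhds (h0.1.mem_nhds (by simpa using hx))
      filter_upwards [this] with s hs
      exact inner_gradY h0 hs hy ζ
    have := (heq.hasDerivAt_iff.1 hg).unique hg2
    rw [← this]; simp

lemma exists_acc {n : ℕ} {c : Euc n → Euc n → ℝ} {U V : Set (Euc n)} (h0 : B0cond n c U V)
    (h1 : B1cond n c U V) {x y : Euc n} (hx : x ∈ U) (hy : y ∈ V) (ξ : Euc n) :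
    ∃ a, ∀ ζ, LL (ξ, 0) (a, 0) (dd (0, ζ) (Function.uncurry c)) (x, y) = 0 := by
  obtain ⟨e, -, he⟩ := mixed h0 h1 hx hy
  set A := (fderiv ℝ (dd (ξ, 0) (dd (ξ, 0) (Function.uncurry c))) (x, y)).comp
      (ContinuousLinearMap.inr ℝ (Euc n) (Euc n)) with hA
  set w := (InnerProductSpace.toDual ℝ (Euc n)).symm A with hw
  refine ⟨e.symm (-w), fun ζ => ?_⟩
  simp only [LL]
  rw [he]
  have hO := openO h0
  have hz : (x, y) ∈ U ×ˢ V := ⟨hx, hy⟩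
  have hC := smoothO h0
  rw [dd_congr hO (dd_comm hO (by omega) hC (ξ, 0) (0, ζ)) (ξ, 0) hz,
    dd_comm hO (m := 3) (by omega) (dd_contDiffOn hO 3 rfl hC (ξ, 0)) (ξ, 0) (0, ζ) hz]
  simp only [ContinuousLinearEquiv.apply_symm_apply, inner_neg_left, hw]
  rw [InnerProductSpace.toDual_symm_apply]
  simp [hA, dd]

lemma acc_unique {n : ℕ} {c : Euc n → Euc n → ℝ} {U V : Set (Euc n)} (h0 : B0cond n c U V)
    (h1 : B1cond n c U V) {x y : Euc n} (hx : x ∈ U) (hy : y ∈ V) {ξ a b : Euc n}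
    (ha : ∀ ζ, LL (ξ, 0) (a, 0) (dd (0, ζ) (Function.uncurry c)) (x, y) = 0)
    (hb : ∀ ζ, LL (ξ, 0) (b, 0) (dd (0, ζ) (Function.uncurry c)) (x, y) = 0) : a = b := by
  obtain ⟨e, -, he⟩ := mixed h0 h1 hx hy
  apply e.injective
  apply ext_inner_right ℝ
  intro ζ
  have h1 := ha ζ
  have h2 := hb ζ
  simp only [LL] at h1 h2
  rw [he] at h1 h2
  linarith

section curves
variable {n : ℕ} {O : Set (Euc n × Euc n)} {F : Euc n × Euc n → ℝ} {m : ℕ}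

lemma deriv_pair_x {γ : ℝ → Euc n} {t : ℝ} (y : Euc n) (h : DifferentiableAt ℝ γ t) :
    deriv (fun s => (γ s, y)) t = (deriv γ t, 0) :=
  (h.hasDerivAt.prodMk (hasDerivAt_const t y)).deriv

lemma deriv_pair_y {γ : ℝ → Euc n} {t : ℝ} (x : Euc n) (h : DifferentiableAt ℝ γ t) :
    deriv (fun s => (x, γ s)) t = (0, deriv γ t) :=
  ((hasDerivAt_const t x).prodMk h.hasDerivAt).deriv

lemma ev_deriv_pair_x {γ : ℝ → Euc n} {t : ℝ} (y : Euc n) (h : ContDiffAt ℝ 2 γ t) :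
    deriv (fun s => (γ s, y)) =ᶠ[𝓝 t] fun s => (deriv γ s, 0) := by
  filter_upwards [h.eventually (by norm_num)] with s hs
  exact deriv_pair_x y (hs.differentiableAt (by norm_num))

lemma ev_deriv_pair_y {γ : ℝ → Euc n} {t : ℝ} (y : Euc n) (h : ContDiffAt ℝ 2 γ t) :
    deriv (fun s => (y, γ s)) =ᶠ[𝓝 t] fun s => (0, deriv γ s) := by
  filter_upwards [h.eventually (by norm_num)] with s hs
  exact deriv_pair_y y (hs.differentiableAt (by norm_num))

lemma deriv_differentiable {γ : ℝ → Euc n} {t : ℝ} (h : ContDiffAt ℝ 2 γ t) :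
    DifferentiableAt ℝ (deriv γ) t := by
  have : ContDiffAt ℝ 1 (fderiv ℝ γ) t := h.fderiv_right (by norm_num)
  have := this.differentiableAt (by norm_num)
  exact this.clm_apply (differentiableAt_const (1:ℝ))

lemma comp_x1 (hO : IsOpen O) (hm : 1 ≤ m) (hF : ContDiffOn ℝ m F O) {γ : ℝ → Euc n} {t : ℝ}
    {y : Euc n} (hγ : DifferentiableAt ℝ γ t) (ht : (γ t, y) ∈ O) :
    HasDerivAt (fun s => F (γ s, y)) (dd (deriv γ t, 0) F (γ t, y)) t := by
  have := hasDerivAt_comp_curve hO hm hF (γ := fun s => (γ s, y)) (t := t) (by fun_prop) ht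
  rwa [deriv_pair_x y hγ] at this

lemma comp_y1 (hO : IsOpen O) (hm : 1 ≤ m) (hF : ContDiffOn ℝ m F O) {γ : ℝ → Euc n} {t : ℝ}
    {x : Euc n} (hγ : DifferentiableAt ℝ γ t) (ht : (x, γ t) ∈ O) :
    HasDerivAt (fun s => F (x, γ s)) (dd (0, deriv γ t) F (x, γ t)) t := by
  have := hasDerivAt_comp_curve hO hm hF (γ := fun s => (x, γ s)) (t := t) (by fun_prop) ht
  rwa [deriv_pair_y x hγ] at this

lemma comp_x2 (hO : IsOpen O) (hm : 2 ≤ m) (hF : ContDiffOn ℝ m F O) {γ : ℝ → Euc n} {t : ℝ}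
    {y : Euc n} (hγ : ContDiffAt ℝ 2 γ t) (ht : (γ t, y) ∈ O) :
    HasDerivAt (fun s => dd (deriv γ s, 0) F (γ s, y))
      (LL (deriv γ t, 0) (deriv (deriv γ) t, 0) F (γ t, y)) t := by
  have := hasDerivAt_comp_curve2 hO hm hF (γ := fun s => (γ s, y)) (t := t)
    (hγ.prodMk contDiffAt_const) ht
  have e := ev_deriv_pair_x y hγ
  rw [e.deriv_eq, e.eq_of_nhds, deriv_pair_x 0 (deriv_differentiable hγ)] at this
  refine this.congr_of_eventuallyEq ?_
  filter_upwards [e] with s hs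
  rw [hs]

lemma comp_y2 (hO : IsOpen O) (hm : 2 ≤ m) (hF : ContDiffOn ℝ m F O) {γ : ℝ → Euc n} {t : ℝ}
    {x : Euc n} (hγ : ContDiffAt ℝ 2 γ t) (ht : (x, γ t) ∈ O) :
    HasDerivAt (fun s => dd (0, deriv γ s) F (x, γ s))
      (LL (0, deriv γ t) (0, deriv (deriv γ) t) F (x, γ t)) t := by
  have := hasDerivAt_comp_curve2 hO hm hF (γ := fun s => (x, γ s)) (t := t)
    (contDiffAt_const.prodMk hγ) ht
  have e := ev_deriv_pair_y x hγ
  rw [e.deriv_eq, e.eq_of_nhds, deriv_pair_y 0 (deriv_differentiable hγ)] at this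
  refine this.congr_of_eventuallyEq ?_
  filter_upwards [e] with s hs
  rw [hs]

lemma deriv2_x (hO : IsOpen O) (hm : 2 ≤ m) (hF : ContDiffOn ℝ m F O) {γ : ℝ → Euc n} {t : ℝ}
    {y : Euc n} (hγ : ContDiffAt ℝ 2 γ t) (ht : (γ t, y) ∈ O) :
    deriv (deriv (fun s => F (γ s, y))) t =
      LL (deriv γ t, 0) (deriv (deriv γ) t, 0) F (γ t, y) := by
  rw [deriv2_comp_curve hO hm hF (γ := fun s => (γ s, y)) (hγ.prodMk contDiffAt_const) ht]
  have e := ev_deriv_pair_x y hγ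
  rw [e.deriv_eq, e.eq_of_nhds, deriv_pair_x 0 (deriv_differentiable hγ)]

lemma deriv2_y (hO : IsOpen O) (hm : 2 ≤ m) (hF : ContDiffOn ℝ m F O) {γ : ℝ → Euc n} {t : ℝ}
    {x : Euc n} (hγ : ContDiffAt ℝ 2 γ t) (ht : (x, γ t) ∈ O) :
    deriv (deriv (fun s => F (x, γ s))) t =
      LL (0, deriv γ t) (0, deriv (deriv γ) t) F (x, γ t) := by
  rw [deriv2_comp_curve hO hm hF (γ := fun s => (x, γ s)) (contDiffAt_const.prodMk hγ) ht]
  have e := ev_deriv_pair_y x hγ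
  rw [e.deriv_eq, e.eq_of_nhds, deriv_pair_y 0 (deriv_differentiable hγ)]

end curves

/-- The MTW condition in infinitesimal (symmetric) form; `full` removes the orthogonality. -/
def MTW (n : ℕ) (c : Euc n → Euc n → ℝ) (U V : Set (Euc n)) (full : Prop) : Prop :=
  ∀ x ∈ U, ∀ y ∈ V, ∀ ξ a η b : Euc n,
    (full ∨ dd (ξ, 0) (dd (0, η) (Function.uncurry c)) (x, y) = 0) →
    (∀ ζ, LL (ξ, 0) (a, 0) (dd (0, ζ) (Function.uncurry c)) (x, y) = 0) →
    (∀ ζ, LL (0, η) (0, b) (dd (ζ, 0) (Function.uncurry c)) (x, y) = 0) →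
    LL (ξ, 0) (a, 0) (LL (0, η) (0, b) (Function.uncurry c)) (x, y) ≤ 0

lemma MTWflip {n : ℕ} {c : Euc n → Euc n → ℝ} {U V : Set (Euc n)} {full : Prop}
    (h0 : B0cond n c U V) (h : MTW n c U V full) : MTW n (fun y x => c x y) V U full := by
  intro y hy x hx η b ξ a h1 h2 h3
  have e : Function.uncurry (fun y x => c x y) = Function.uncurry c ∘ Prod.swap := rfl
  have hz : (x, y) ∈ U ×ˢ V := ⟨hx, hy⟩
  rw [e] at h1 h2 h3 ⊢
  simp only [dd_swap, LL_swap, Function.comp, Prod.swap_prod_mk] at h1 h2 h3 ⊢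
  rw [LL_comm (openO h0) (smoothO h0) _ _ _ _ hz]
  refine h x hx y hy ξ a η b (h1.imp id fun h4 => ?_) h3 h2
  rw [dd_comm (openO h0) (by omega) (smoothO h0) _ _ hz]; exact h4

section seg
variable {n : ℕ} {c : Euc n → Euc n → ℝ} {U V : Set (Euc n)}

lemma seg_smooth (h0 : B0cond n c U V) (h1 : B1cond n c U V) {y : Euc n} (hy : y ∈ V)
    {q e : Euc n} {t : ℝ} (ht : q + t • e ∈ Uyset n c U y) :
    ContDiffAt ℝ 3 (fun s : ℝ => xOf n c U y (q + s • e)) t := by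
  have h := (chart h0 h1 hy ht).2.2
  exact h.comp t (by fun_prop)

lemma seg_ev (h0 : B0cond n c U V) (h1 : B1cond n c U V) {y : Euc n} (hy : y ∈ V)
    {q e : Euc n} {t : ℝ} (ht : q + t • e ∈ Uyset n c U y) :
    ∀ᶠ s : ℝ in 𝓝 t, q + s • e ∈ Uyset n c U y := by
  have hc : ContinuousAt (fun s : ℝ => q + s • e) t := by fun_prop
  exact hc.preimage_mem_nhds ((Uy_open h0 h1 (subset_closure hy)).mem_nhds ht)

lemma seg_val (h0 : B0cond n c U V) (h1 : B1cond n c U V) {y : Euc n} (hy : y ∈ V)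
    {q e : Euc n} {t : ℝ} (ht : q + t • e ∈ Uyset n c U y) (ζ : Euc n) :
    dd (0, ζ) (Function.uncurry c) (xOf n c U y (q + t • e), y) =
      -(inner ℝ q ζ + t * inner ℝ e ζ) := by
  obtain ⟨h2, h3, -⟩ := chart h0 h1 hy ht
  rw [← inner_gradY h0 h2 hy, ← neg_neg (gradY n c _ y), h3]
  simp [inner_add_left, inner_smul_left]

lemma seg_vel (h0 : B0cond n c U V) (h1 : B1cond n c U V) {y : Euc n} (hy : y ∈ V)
    {q e : Euc n} {t : ℝ} (ht : q + t • e ∈ Uyset n c U y) (ζ : Euc n) :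
    dd (deriv (fun s : ℝ => xOf n c U y (q + s • e)) t, 0) (dd (0, ζ) (Function.uncurry c))
      (xOf n c U y (q + t • e), y) = -inner ℝ e ζ := by
  have hd := comp_x1 (openO h0) (m := 3) (by omega)
    (dd_contDiffOn (openO h0) 3 rfl (smoothO h0) (0, ζ))
    (γ := fun s : ℝ => xOf n c U y (q + s • e)) (t := t) (y := y)
    ((seg_smooth h0 h1 hy ht).differentiableAt (by norm_num)) ⟨(chart h0 h1 hy ht).1, hy⟩
  have he : (fun s : ℝ => dd (0, ζ) (Function.uncurry c) (xOf n c U y (q + s • e), y)) =ᶠ[𝓝 t]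
      fun s => -(inner ℝ q ζ + s * inner ℝ e ζ) := by
    filter_upwards [seg_ev h0 h1 hy ht] with s hs
    exact seg_val h0 h1 hy hs ζ
  have hd2 : HasDerivAt (fun s : ℝ => -(inner ℝ q ζ + s * inner ℝ e ζ)) (-inner ℝ e ζ) t := by
    have h9 := (((hasDerivAt_id t).mul_const (inner ℝ e ζ)).const_add (inner ℝ q ζ)).neg
    exact HasDerivAt.congr_deriv h9 (by simp)
  exact (he.hasDerivAt_iff.1 hd).unique hd2

lemma seg_acc (h0 : B0cond n c U V) (h1 : B1cond n c U V) {y : Euc n} (hy : y ∈ V)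
    {q e : Euc n} {t : ℝ} (ht : q + t • e ∈ Uyset n c U y) (ζ : Euc n) :
    LL (deriv (fun s : ℝ => xOf n c U y (q + s • e)) t, 0)
      (deriv (deriv (fun s : ℝ => xOf n c U y (q + s • e))) t, 0) (dd (0, ζ) (Function.uncurry c))
      (xOf n c U y (q + t • e), y) = 0 := by
  have hd := comp_x2 (openO h0) (m := 3) (by omega)
    (dd_contDiffOn (openO h0) 3 rfl (smoothO h0) (0, ζ))
    (γ := fun s : ℝ => xOf n c U y (q + s • e)) (t := t) (y := y)
    ((seg_smooth h0 h1 hy ht).of_le (by norm_num)) ⟨(chart h0 h1 hy ht).1, hy⟩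
  have he : (fun s : ℝ => dd (deriv (fun s : ℝ => xOf n c U y (q + s • e)) s, 0)
      (dd (0, ζ) (Function.uncurry c)) (xOf n c U y (q + s • e), y)) =ᶠ[𝓝 t]
      fun s => -inner ℝ e ζ := by
    filter_upwards [seg_ev h0 h1 hy ht] with s hs
    exact seg_vel h0 h1 hy hs ζ
  exact (he.hasDerivAt_iff.1 hd).unique (hasDerivAt_const _ _)

/-- curve through a point with prescribed (scaled) jet -/
lemma exists_curve (h0 : B0cond n c U V) (h1 : B1cond n c U V) {x y : Euc n} (hx : x ∈ U)
    (hy : y ∈ V) {ξ a : Euc n}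
    (ha : ∀ ζ, LL (ξ, 0) (a, 0) (dd (0, ζ) (Function.uncurry c)) (x, y) = 0) :
    ∃ δ > (0:ℝ), ∃ γ : ℝ → Euc n, (∀ t ∈ Icc (-1:ℝ) 1, γ t ∈ U) ∧ ContDiffAt ℝ 2 γ 0 ∧ γ 0 = x ∧
      deriv γ 0 = δ • ξ ∧ deriv (deriv γ) 0 = δ ^ 2 • a ∧
      ∃ A B : Euc n, ∀ t ∈ Icc (-1:ℝ) 1, gradY n c (γ t) y = A + t • B := by
  obtain ⟨e, -, he⟩ := mixed h0 h1 hx hy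
  set q := -gradY n c x y with hq
  have hqU : q ∈ Uyset n c U y := ⟨x, hx, rfl⟩
  obtain ⟨r, hr, hball⟩ := Metric.isOpen_iff.1 (Uy_open h0 h1 (subset_closure hy)) q hqU
  obtain ⟨δ, hδ, hδ2⟩ : ∃ δ > (0:ℝ), δ * ‖e ξ‖ < r := by
    refine ⟨r / (‖e ξ‖ + 1), by positivity, ?_⟩
    rw [div_mul_eq_mul_div, div_lt_iff₀ (by positivity)]
    nlinarith [norm_nonneg (e ξ)]
  have hin : ∀ t ∈ Icc (-1:ℝ) 1, q + t • (-(δ • e ξ)) ∈ Uyset n c U y := by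
    intro t ht
    apply hball
    rw [mem_ball_iff_norm, add_sub_cancel_left, norm_smul, norm_neg, norm_smul,
      Real.norm_of_nonneg hδ.le]
    have : ‖t‖ ≤ 1 := abs_le.2 ⟨ht.1, ht.2⟩
    calc ‖t‖ * (δ * ‖e ξ‖) ≤ 1 * (δ * ‖e ξ‖) := by gcongr
      _ < r := by linarith
  have h00 : (0:ℝ) ∈ Icc (-1:ℝ) 1 := by constructor <;> norm_num
  have hx0 : xOf n c U y (q + (0:ℝ) • (-(δ • e ξ))) = x := by
    rw [zero_smul, add_zero]
    exact invFunOn_apply (h1.1 y (subset_closure hy)).1 (subset_closure hx)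
  set γ : ℝ → Euc n := fun s => xOf n c U y (q + s • (-(δ • e ξ))) with hγ
  have hv : deriv γ 0 = δ • ξ := by
    apply e.injective
    apply ext_inner_right ℝ
    intro ζ
    have := seg_vel h0 h1 hy (hin 0 h00) ζ
    rw [hx0, he] at this
    rw [this]; simp
  refine ⟨δ, hδ, γ, fun t ht => (chart h0 h1 hy (hin t ht)).1,
    (seg_smooth h0 h1 hy (hin 0 h00)).of_le (by norm_num), hx0, hv, ?_,
    -q, δ • e ξ, fun t ht => ?_⟩
  · have h3 := seg_acc h0 h1 hy (hin 0 h00)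
    rw [hx0] at h3
    change ∀ ζ, LL (deriv γ 0, 0) (deriv (deriv γ) 0, 0) _ _ = 0 at h3
    rw [hv] at h3
    refine acc_unique h0 h1 hx hy h3 fun ζ => ?_
    have h4 := congrFun (LL_scale δ ((ξ, 0) : Euc n × Euc n) (a, 0)
      (dd (0, ζ) (Function.uncurry c))) (x, y)
    simp only [Prod.smul_mk, smul_zero] at h4
    rw [h4, ha]; simp
  · have h5 := (chart h0 h1 hy (hin t ht)).2.1
    change gradY n c (xOf n c U y (q + t • (-(δ • e ξ)))) y = _
    rw [← neg_neg (gradY n c _ y), h5]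
    simp; abel

lemma MTW_aux (h0 : B0cond n c U V) (h1 : B1cond n c U V) (full : Prop)
    (hB : ∀ x y : ℝ → Euc n, (∀ t ∈ Icc (-1 : ℝ) 1, x t ∈ closure U) →
      (∀ t ∈ Icc (-1 : ℝ) 1, y t ∈ closure V) →
      IsAffineSeg n (fun t => (gradY n c (x t) (y 0), gradX n c (x 0) (y t))) →
      (full ∨ crossDiff2 n c x y = 0) → crossDiff4 n c x y ≤ 0) : MTW n c U V full := by
  intro x hx y hy ξ a η b hfull ha hb
  obtain ⟨δ, hδ, γ, hγU, hγs, hγ0, hγ1, hγ2, A, B, hAB⟩ := exists_curve h0 h1 hx hy ha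
  have hb' : ∀ ζ, LL (η, 0) (b, 0) (dd (0, ζ) (Function.uncurry fun y x => c x y)) (y, x) = 0 := by
    intro ζ
    have e : Function.uncurry (fun y x => c x y) = Function.uncurry c ∘ Prod.swap := rfl
    rw [e]
    simp only [dd_swap, LL_swap, Function.comp, Prod.swap_prod_mk]
    exact hb ζ
  obtain ⟨δ', hδ', γ', hγU', hγs', hγ0', hγ1', hγ2', A', B', hAB'⟩ :=
    exists_curve (B0flip h0) (B1flip h1) hy hx hb'
  have hO := openO h0
  have hC := smoothO h0
  have hz : (x, y) ∈ U ×ˢ V := ⟨hx, hy⟩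
  have hevx : ∀ᶠ s in 𝓝 (0:ℝ), γ s ∈ U :=
    hγs.continuousAt.preimage_mem_nhds (h0.1.mem_nhds (hγ0.symm ▸ hx))
  have hmain := hB γ γ' (fun t ht => subset_closure (hγU t ht))
    (fun t ht => subset_closure (hγU' t ht)) ⟨(A, A'), (B, B'), fun t ht => ?_⟩ ?_
  · have e1 : (fun s => deriv (deriv (fun t => c (γ s) (γ' t))) 0) =ᶠ[𝓝 0]
        fun s => LL (0, δ' • η) (0, δ' ^ 2 • b) (Function.uncurry c) (γ s, y) := by
      filter_upwards [hevx] with s hs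
      have := deriv2_y hO (by omega) hC (x := γ s) hγs' (by rw [hγ0']; exact ⟨hs, hy⟩)
      rw [hγ0', hγ1', hγ2'] at this
      exact this
    have e2 : crossDiff4 n c γ γ' = LL (δ • ξ, 0) (δ ^ 2 • a, 0)
        (LL (0, δ' • η) (0, δ' ^ 2 • b) (Function.uncurry c)) (x, y) := by
      unfold crossDiff4
      rw [e1.deriv.deriv_eq, deriv2_x hO (m := 2) le_rfl (LL_contDiffOn hO 2 rfl hC _ _) hγs
        (by rw [hγ0]; exact hz), hγ0, hγ1, hγ2]
    rw [e2] at hmain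
    have s1 := LL_scale δ' ((0, η) : Euc n × Euc n) (0, b) (Function.uncurry c)
    simp only [Prod.smul_mk, smul_zero] at s1
    rw [s1, LL_const_mul] at hmain
    have s2 := LL_scale δ ((ξ, 0) : Euc n × Euc n) (a, 0) (LL (0, η) (0, b) (Function.uncurry c))
    simp only [Prod.smul_mk, smul_zero] at s2
    rw [s2] at hmain
    have hp : 0 < δ' ^ 2 * δ ^ 2 := by positivity
    by_contra hcon
    push Not at hcon
    have := mul_pos hp hcon
    simp only at hmain
    linarith
  · have h3 := hAB t ht
    have h4 : gradX n c x (γ' t) = A' + t • B' := hAB' t ht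
    simp only [hγ0', hγ0, h3, h4]
    rfl
  · refine hfull.imp id fun h3 => ?_
    have e1 : (fun s => deriv (fun t => c (γ s) (γ' t)) 0) =ᶠ[𝓝 0]
        fun s => dd (0, δ' • η) (Function.uncurry c) (γ s, y) := by
      filter_upwards [hevx] with s hs
      have := (comp_y1 hO (by omega) hC (x := γ s) (hγs'.differentiableAt (by norm_num))
        (by rw [hγ0']; exact ⟨hs, hy⟩)).deriv
      rw [hγ0', hγ1'] at this
      exact this
    unfold crossDiff2
    rw [e1.deriv_eq, (comp_x1 hO (m := 3) (by omega) (dd_contDiffOn hO 3 rfl hC _)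
      (hγs.differentiableAt (by norm_num)) (by rw [hγ0]; exact hz)).deriv, hγ0, hγ1]
    have s1 : dd (0, δ' • η) (Function.uncurry c) =
        fun z => δ' * dd (0, η) (Function.uncurry c) z := by
      funext z
      have := dd_smul δ' ((0, η) : Euc n × Euc n) (Function.uncurry c) z
      simpa using this
    have s2 := dd_smul δ ((ξ, 0) : Euc n × Euc n)
      (fun z => δ' * dd (0, η) (Function.uncurry c) z) (x, y)
    simp only [Prod.smul_mk, smul_zero] at s2
    rw [s1, s2, dd_const_mul]
    simp [h3]

lemma MTW_of_B3 (h0 : B0cond n c U V) (h1 : B1cond n c U V) (h3 : B3cond n c U V) :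
    MTW n c U V False :=
  MTW_aux h0 h1 False fun x y hx hy ha h => h3 x y hx hy ha (h.resolve_left id)

lemma MTW_of_B4 (h0 : B0cond n c U V) (h1 : B1cond n c U V) (h4 : B4cond n c U V) :
    MTW n c U V True :=
  MTW_aux h0 h1 True fun x y hx hy ha _ => h4 x y hx hy ha

end seg

/-- inverse of the dual coordinate change -/
noncomputable def yOf (n : ℕ) (c : Euc n → Euc n → ℝ) (V : Set (Euc n)) (x : Euc n) :
    Euc n → Euc n := xOf n (fun y x => c x y) V x

section yseg
variable {n : ℕ} {c : Euc n → Euc n → ℝ} {U V : Set (Euc n)}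

lemma ychart (h0 : B0cond n c U V) (h1 : B1cond n c U V) {x : Euc n} (hx : x ∈ U) {q : Euc n}
    (hq : q ∈ Vxset n c V x) :
    yOf n c V x q ∈ V ∧ -gradX n c x (yOf n c V x q) = q ∧ ContDiffAt ℝ 3 (yOf n c V x) q :=
  chart (B0flip h0) (B1flip h1) hx hq

lemma yseg_val (h0 : B0cond n c U V) (h1 : B1cond n c U V) {x : Euc n} (hx : x ∈ U)
    {q e : Euc n} {t : ℝ} (ht : q + t • e ∈ Vxset n c V x) (ζ : Euc n) :
    dd (ζ, 0) (Function.uncurry c) (x, yOf n c V x (q + t • e)) =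
      -(inner ℝ q ζ + t * inner ℝ e ζ) := by
  have := seg_val (B0flip h0) (B1flip h1) hx ht ζ
  have e : Function.uncurry (fun y x => c x y) = Function.uncurry c ∘ Prod.swap := rfl
  rw [e] at this
  simp only [dd_swap, LL_swap, Function.comp, Prod.swap_prod_mk] at this
  exact this

lemma yseg_vel (h0 : B0cond n c U V) (h1 : B1cond n c U V) {x : Euc n} (hx : x ∈ U)
    {q e : Euc n} {t : ℝ} (ht : q + t • e ∈ Vxset n c V x) (ζ : Euc n) :
    dd (0, deriv (fun s : ℝ => yOf n c V x (q + s • e)) t) (dd (ζ, 0) (Function.uncurry c))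
      (x, yOf n c V x (q + t • e)) = -inner ℝ e ζ := by
  have := seg_vel (B0flip h0) (B1flip h1) hx ht ζ
  have e : Function.uncurry (fun y x => c x y) = Function.uncurry c ∘ Prod.swap := rfl
  rw [e] at this
  simp only [dd_swap, LL_swap, Function.comp, Prod.swap_prod_mk] at this
  exact this

lemma yseg_acc (h0 : B0cond n c U V) (h1 : B1cond n c U V) {x : Euc n} (hx : x ∈ U)
    {q e : Euc n} {t : ℝ} (ht : q + t • e ∈ Vxset n c V x) (ζ : Euc n) :
    LL (0, deriv (fun s : ℝ => yOf n c V x (q + s • e)) t)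
      (0, deriv (deriv (fun s : ℝ => yOf n c V x (q + s • e))) t) (dd (ζ, 0) (Function.uncurry c))
      (x, yOf n c V x (q + t • e)) = 0 := by
  have := seg_acc (B0flip h0) (B1flip h1) hx ht ζ
  have e : Function.uncurry (fun y x => c x y) = Function.uncurry c ∘ Prod.swap := rfl
  rw [e] at this
  simp only [dd_swap, LL_swap, Function.comp, Prod.swap_prod_mk] at this
  exact this

lemma inner_gradX (h0 : B0cond n c U V) {x y : Euc n} (hx : x ∈ U) (hy : y ∈ V) (ζ : Euc n) :
    inner ℝ (gradX n c x y) ζ = dd (ζ, 0) (Function.uncurry c) (x, y) := by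
  have := inner_gradY (B0flip h0) hy hx ζ
  have e : Function.uncurry (fun y x => c x y) = Function.uncurry c ∘ Prod.swap := rfl
  rw [e] at this
  simp only [dd_swap, LL_swap, Function.comp, Prod.swap_prod_mk] at this
  exact this

lemma seg_mem {S : Set (Euc n)} (hS : Convex ℝ S) {p q : Euc n} (hp : p ∈ S) (hq : q ∈ S) {t : ℝ}
    (ht : t ∈ Icc (0:ℝ) 1) : p + t • (q - p) ∈ S :=
  hS.add_smul_sub_mem hp hq ht

/-- a function with vanishing slope at 0 and nonpositive second derivative on `[0,1]` satisfies `G(1) ≤ G(0)` -/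
lemma concave_le {G G' G'' : ℝ → ℝ} (h1 : ∀ t ∈ Icc (0:ℝ) 1, HasDerivAt G (G' t) t)
    (h2 : ∀ t ∈ Icc (0:ℝ) 1, HasDerivAt G' (G'' t) t) (h3 : ∀ t ∈ Icc (0:ℝ) 1, G'' t ≤ 0)
    (h4 : G' 0 = 0) : G 1 ≤ G 0 := by
  have hi : interior (Icc (0:ℝ) 1) ⊆ Icc 0 1 := interior_subset
  have a1 : AntitoneOn G' (Icc 0 1) := by
    apply antitoneOn_of_deriv_nonpos (convex_Icc 0 1)
      (fun t ht => (h2 t ht).continuousAt.continuousWithinAt)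
      (fun t ht => (h2 t (hi ht)).differentiableAt.differentiableWithinAt)
    intro t ht
    rw [(h2 t (hi ht)).deriv]; exact h3 t (hi ht)
  have h00 : (0:ℝ) ∈ Icc (0:ℝ) 1 := by simp
  have h11 : (1:ℝ) ∈ Icc (0:ℝ) 1 := by simp
  have a2 : AntitoneOn G (Icc 0 1) := by
    apply antitoneOn_of_deriv_nonpos (convex_Icc 0 1)
      (fun t ht => (h1 t ht).continuousAt.continuousWithinAt)
      (fun t ht => (h1 t (hi ht)).differentiableAt.differentiableWithinAt)
    intro t ht
    rw [(h1 t (hi ht)).deriv, ← h4]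
    exact a1 h00 (hi ht) (hi ht).1
  exact a2 h00 h11 zero_le_one

lemma keyK (h0 : B0cond n c U V) (h1 : B1cond n c U V) (h2 : B2cond n c U V) {full : Prop}
    (hM : MTW n c U V full) {x yb y : Euc n} (hx : x ∈ U) (hyb : yb ∈ V) (hy : y ∈ V)
    {ξ a : Euc n} (ha : ∀ ζ, LL (ξ, 0) (a, 0) (dd (0, ζ) (Function.uncurry c)) (x, yb) = 0)
    (hf : full ∨ dd (ξ, 0) (Function.uncurry c) (x, y) = dd (ξ, 0) (Function.uncurry c) (x, yb)) :
    LL (ξ, 0) (a, 0) (Function.uncurry c) (x, y) ≤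
      LL (ξ, 0) (a, 0) (Function.uncurry c) (x, yb) := by
  set C := Function.uncurry c with hCdef
  set pb := -gradX n c x yb with hpb
  set p := -gradX n c x y with hp
  have hO := openO h0
  have hC := smoothO h0
  have hmem : ∀ t ∈ Icc (0:ℝ) 1, pb + t • (p - pb) ∈ Vxset n c V x := fun t ht =>
    seg_mem (h2.2 x (subset_closure hx)) ⟨yb, hyb, rfl⟩ ⟨y, hy, rfl⟩ ht
  set γ : ℝ → Euc n := fun s => yOf n c V x (pb + s • (p - pb)) with hγ
  have hinj := (h1.2 x (subset_closure hx)).1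
  have g0 : γ 0 = yb := by
    simp only [hγ, zero_smul, add_zero]
    exact invFunOn_apply hinj (subset_closure hyb)
  have g1 : γ 1 = y := by
    simp only [hγ, one_smul, add_sub_cancel]
    exact invFunOn_apply hinj (subset_closure hy)
  have hV : ∀ t ∈ Icc (0:ℝ) 1, (x, γ t) ∈ U ×ˢ V := fun t ht =>
    ⟨hx, (ychart h0 h1 hx (hmem t ht)).1⟩
  have hs : ∀ t ∈ Icc (0:ℝ) 1, ContDiffAt ℝ 3 γ t := fun t ht =>
    seg_smooth (B0flip h0) (B1flip h1) hx (hmem t ht)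
  set F := LL (ξ, 0) (a, 0) C with hF
  have hFs : ContDiffOn ℝ ((2:ℕ)) F (U ×ˢ V) := LL_contDiffOn hO 2 rfl hC _ _
  have key := concave_le (G := fun s => F (x, γ s)) (G' := fun s => dd (0, deriv γ s) F (x, γ s))
    (G'' := fun s => LL (0, deriv γ s) (0, deriv (deriv γ) s) F (x, γ s))
    (fun t ht => comp_y1 hO (by omega) hFs ((hs t ht).differentiableAt (by norm_num)) (hV t ht))
    (fun t ht => comp_y2 hO le_rfl hFs ((hs t ht).of_le (by norm_num)) (hV t ht))
    (fun t ht => ?_) ?_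
  · simpa only [g0, g1] using key
  · set η := deriv γ t with hη
    set b := deriv (deriv γ) t with hb
    have hbz : ∀ ζ, LL (0, η) (0, b) (dd (ζ, 0) C) (x, γ t) = 0 := fun ζ =>
      yseg_acc h0 h1 hx (hmem t ht) ζ
    obtain ⟨a', ha'⟩ := exists_acc h0 h1 hx (hV t ht).2 ξ
    have e1 : ∀ w, LL (ξ, 0) (w, 0) (LL (0, η) (0, b) C) (x, γ t) =
        dd (ξ, 0) (dd (ξ, 0) (LL (0, η) (0, b) C)) (x, γ t) := by
      intro w
      have : dd (w, 0) (LL (0, η) (0, b) C) (x, γ t) = 0 := by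
        rw [← LL_dd_comm hO (by omega) hC _ _ _ (hV t ht)]; exact hbz w
      unfold LL at this ⊢
      rw [this, add_zero]
    rw [← LL_comm hO hC _ _ _ _ (hV t ht), e1 a, ← e1 a']
    refine hM x hx (γ t) (hV t ht).2 ξ a' η b (hf.imp id fun h => ?_) ha' hbz
    rw [dd_comm hO (by omega) hC _ _ (hV t ht)]
    have e2 : dd (0, η) (dd (ξ, 0) C) (x, γ t) = _ := yseg_vel h0 h1 hx (hmem t ht) ξ
    rw [e2, inner_sub_left, hpb, hp, inner_neg_left, inner_neg_left, inner_gradX h0 hx hy,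
      inner_gradX h0 hx hyb, h]
    ring
  · have h00 : (0:ℝ) ∈ Icc (0:ℝ) 1 := by simp
    rw [hF, ← LL_dd_comm hO (by omega) hC _ _ _ (hV 0 h00), g0]
    exact ha _
end yseg

section real
lemma local_est {φ T φμ Tμ : ℝ → ℝ → ℝ} {T0 : ℝ → ℝ} {t0 : ℝ}
    (h1 : ∀ᶠ z : ℝ × ℝ in 𝓝 (t0, 0), HasDerivAt (φ z.1) (φμ z.1 z.2) z.2)
    (h2 : ∀ᶠ z : ℝ × ℝ in 𝓝 (t0, 0), HasDerivAt (T z.1) (Tμ z.1 z.2) z.2)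
    (c1 : ContinuousAt (fun z : ℝ × ℝ => φμ z.1 z.2) (t0, 0))
    (c2 : ContinuousAt (fun z : ℝ × ℝ => Tμ z.1 z.2) (t0, 0))
    (c3 : ContinuousAt (fun t => φ t 0) t0) (hz : φ t0 0 = 0) (hp : 0 < φμ t0 0)
    (hK : ∀ᶠ z : ℝ × ℝ in 𝓝 (t0, 0), φ z.1 z.2 = 0 → T z.1 z.2 ≤ T0 z.1) :
    ∃ L, ∀ᶠ t in 𝓝 t0, T t 0 - T0 t ≤ L * |φ t 0| := by
  set k := φμ t0 0 / 2 with hk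
  have hkp : 0 < k := by positivity
  set B := |Tμ t0 0| + 1 with hB
  have a1 : ∀ᶠ z : ℝ × ℝ in 𝓝 (t0, 0), k < φμ z.1 z.2 :=
    c1.eventually (lt_mem_nhds (by simp only [hk]; linarith))
  have a2 : ∀ᶠ z : ℝ × ℝ in 𝓝 (t0, 0), |Tμ z.1 z.2| < B :=
    c2.abs.eventually (gt_mem_nhds (by simp only [hB]; linarith))
  obtain ⟨ρ, hρ, hall⟩ := Metric.eventually_nhds_iff.1 (h1.and (h2.and (a1.and (a2.and hK))))
  have a3 : ∀ᶠ t in 𝓝 t0, |φ t 0| < k * ρ := by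
    refine c3.abs.eventually (gt_mem_nhds ?_)
    simp only [hz, abs_zero]; positivity
  refine ⟨B / k, ?_⟩
  filter_upwards [a3, Metric.ball_mem_nhds t0 hρ] with t ht ht2
  have hin : ∀ μ, |μ| < ρ → dist (t, μ) (t0, (0:ℝ)) < ρ := by
    intro μ hμ
    rw [Prod.dist_eq, max_lt_iff]
    exact ⟨ht2, by simpa [Real.dist_eq] using hμ⟩
  set M := |φ t 0| / k with hM
  have hM0 : 0 ≤ M := by positivity
  have hMρ : M < ρ := by rw [hM, div_lt_iff₀ hkp]; linarith
  have hkM : k * M = |φ t 0| := by rw [hM]; field_simp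
  have hab : ∀ μ ∈ Icc (-M) M, |μ| < ρ := fun μ hμ => (abs_le.2 hμ).trans_lt hMρ
  have hcont : ContinuousOn (φ t) (Icc (-M) M) := fun μ hμ =>
    (hall (hin μ (hab μ hμ))).1.continuousAt.continuousWithinAt
  have mv := (convex_Icc (-M) M).mul_sub_le_image_sub_of_le_deriv hcont
    (fun μ hμ => (hall (hin μ (hab μ (interior_subset hμ)))).1.differentiableAt.differentiableWithinAt)
    (C := k) (fun μ hμ => by
      have := hall (hin μ (hab μ (interior_subset hμ)))
      have e := this.1.deriv
      simp only at e
      rw [e]; exact this.2.2.1.le)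
  have m0 : (0:ℝ) ∈ Icc (-M) M := ⟨by linarith, hM0⟩
  have mp : M ∈ Icc (-M) M := ⟨by linarith, le_rfl⟩
  have mm : -M ∈ Icc (-M) M := ⟨le_rfl, by linarith⟩
  have u1 := mv 0 m0 M mp hM0
  have u2 := mv (-M) mm 0 m0 (by linarith)
  have n1 := neg_abs_le (φ t 0)
  have n2 := le_abs_self (φ t 0)
  obtain ⟨μ, hμ, hμ0⟩ := intermediate_value_Icc (by linarith) hcont
    (show (0:ℝ) ∈ Icc (φ t (-M)) (φ t M) from ⟨by linarith, by linarith⟩)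
  have hTle := (hall (hin μ (hab μ hμ))).2.2.2.2 hμ0
  have lip := (convex_Icc (-M) M).norm_image_sub_le_of_norm_hasDerivWithin_le (f := T t)
    (f' := Tμ t) (C := B)
    (fun ν hν => (hall (hin ν (hab ν hν))).2.1.hasDerivWithinAt)
    (fun ν hν => (hall (hin ν (hab ν hν))).2.2.2.1.le) hμ m0
  have l2 : T t 0 - T t μ ≤ B * M := by
    refine (le_abs_self _).trans (lip.trans ?_)
    have : ‖0 - μ‖ ≤ M := by simpa using abs_le.2 hμ
    have : 0 ≤ B := by positivity
    gcongr
  have e : B / k * |φ t 0| = B * M := by rw [hM]; ring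
  rw [e]
  simp only at hTle
  linarith

lemma ode_up {g g2 : ℝ → ℝ} (h1 : ∀ t ∈ Icc (0:ℝ) 1, HasDerivAt g (g2 t) t)
    (h2 : ∀ t ∈ Icc (0:ℝ) 1, g t = 0 → ∃ L, ∀ᶠ s in 𝓝 t, -L * |g s| ≤ g2 s)
    {t1 t2 : ℝ} (ht1 : t1 ∈ Icc (0:ℝ) 1) (ht2 : t2 ∈ Icc (0:ℝ) 1) (h12 : t1 ≤ t2)
    (hg : 0 < g t1) : 0 < g t2 := by
  by_contra hcon
  push Not at hcon
  have hsub : Icc t1 t2 ⊆ Icc (0:ℝ) 1 := Icc_subset_Icc ht1.1 ht2.2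
  have hc : ContinuousOn g (Icc t1 t2) := fun t ht =>
    (h1 t (hsub ht)).continuousAt.continuousWithinAt
  set S := Icc t1 t2 ∩ g ⁻¹' (Iic 0) with hS
  have hScl : IsClosed S := hc.preimage_isClosed_of_isClosed isClosed_Icc isClosed_Iic
  have hScomp : IsCompact S := isCompact_Icc.of_isClosed_subset hScl inter_subset_left
  obtain ⟨s, hs, hmin⟩ := hScomp.exists_isLeast ⟨t2, ⟨h12, le_rfl⟩, hcon⟩
  have hs1 : t1 < s := lt_of_le_of_ne hs.1.1 fun h => by
    have : g s ≤ 0 := hs.2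
    rw [← h] at this; linarith
  have hpos : ∀ t ∈ Ico t1 s, 0 < g t := by
    intro t ht
    by_contra hn
    push Not at hn
    have := hmin ⟨⟨ht.1, ht.2.le.trans hs.1.2⟩, hn⟩
    linarith [ht.2]
  have hs0 : g s = 0 := by
    apply le_antisymm hs.2
    have hcs : ContinuousWithinAt g (Iio s) s := (h1 s (hsub hs.1)).continuousAt.continuousWithinAt
    refine ge_of_tendsto hcs ?_
    filter_upwards [Ioo_mem_nhdsLT hs1] with t ht
    exact (hpos t ⟨ht.1.le, ht.2⟩).le
  obtain ⟨L, hL⟩ := h2 s (hsub hs.1) hs0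
  obtain ⟨ε, hε, hL⟩ := Metric.eventually_nhds_iff.1 hL
  set r := max t1 (s - ε / 2) with hr
  have hrs : r < s := max_lt hs1 (by linarith)
  have hr1 : t1 ≤ r := le_max_left _ _
  have hr2 : s - ε / 2 ≤ r := le_max_right _ _
  have hd : ∀ t ∈ Icc r s, HasDerivAt (fun t => g t * Real.exp (L * t))
      (g2 t * Real.exp (L * t) + g t * (Real.exp (L * t) * (L * 1))) t := fun t ht =>
    (h1 t (hsub ⟨hr1.trans ht.1, ht.2.trans hs.1.2⟩)).mul
      (((hasDerivAt_id t).const_mul L).exp)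
  have hmono : MonotoneOn (fun t => g t * Real.exp (L * t)) (Icc r s) := by
    apply monotoneOn_of_deriv_nonneg (convex_Icc r s)
      (fun t ht => (hd t ht).continuousAt.continuousWithinAt)
      (fun t ht => (hd t (interior_subset ht)).differentiableAt.differentiableWithinAt)
    intro t ht
    rw [(hd t (interior_subset ht)).deriv]
    rw [interior_Icc] at ht
    have hgt := hpos t ⟨hr1.trans ht.1.le, ht.2⟩
    have := hL (y := t) (by rw [Real.dist_eq, abs_lt]; constructor <;> linarith [ht.1, ht.2])
    rw [abs_of_pos hgt] at this
    have he := Real.exp_pos (L * t)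
    have : 0 ≤ (g2 t + L * g t) * Real.exp (L * t) := mul_nonneg (by linarith) he.le
    linarith
  have := hmono ⟨le_rfl, hrs.le⟩ ⟨hrs.le, le_rfl⟩ hrs.le
  simp only [hs0, zero_mul] at this
  have h5 := mul_pos (hpos r ⟨hr1, hrs⟩) (Real.exp_pos (L * r))
  linarith

lemma ode_down {g g2 : ℝ → ℝ} (h1 : ∀ t ∈ Icc (0:ℝ) 1, HasDerivAt g (g2 t) t)
    (h2 : ∀ t ∈ Icc (0:ℝ) 1, g t = 0 → ∃ L, ∀ᶠ s in 𝓝 t, -L * |g s| ≤ g2 s)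
    {t1 t2 : ℝ} (ht1 : t1 ∈ Icc (0:ℝ) 1) (ht2 : t2 ∈ Icc (0:ℝ) 1) (h12 : t1 ≤ t2)
    (hg : g t2 < 0) : g t1 < 0 := by
  have hm : ∀ t ∈ Icc (0:ℝ) 1, 1 - t ∈ Icc (0:ℝ) 1 := fun t ht =>
    ⟨by linarith [ht.2], by linarith [ht.1]⟩
  have := ode_up (g := fun t => -g (1 - t)) (g2 := fun t => g2 (1 - t)) (fun t ht => ?_)
    (fun t ht h => ?_) (hm t2 ht2) (hm t1 ht1) (by linarith) (by simpa using hg)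
  · simpa using this
  · have h3 := ((h1 (1 - t) (hm t ht)).comp_const_sub 1 t).neg
    exact HasDerivAt.congr_deriv h3 (by simp)
  · obtain ⟨L, hL⟩ := h2 (1 - t) (hm t ht) (by simpa using h)
    refine ⟨L, ?_⟩
    have hc : Tendsto (fun s : ℝ => 1 - s) (𝓝 t) (𝓝 (1 - t)) := by
      apply Continuous.tendsto; fun_prop
    filter_upwards [hc.eventually hL] with s hs
    simpa using hs

lemma qc_max {f g g2 : ℝ → ℝ} (hf : ∀ t ∈ Icc (0:ℝ) 1, HasDerivAt f (g t) t)
    (h1 : ∀ t ∈ Icc (0:ℝ) 1, HasDerivAt g (g2 t) t)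
    (h2 : ∀ t ∈ Icc (0:ℝ) 1, g t = 0 → ∃ L, ∀ᶠ s in 𝓝 t, -L * |g s| ≤ g2 s)
    {t : ℝ} (ht : t ∈ Icc (0:ℝ) 1) : f t ≤ max (f 0) (f 1) := by
  have hcf : ContinuousOn f (Icc 0 1) := fun t ht => (hf t ht).continuousAt.continuousWithinAt
  by_cases hc : ∃ s ∈ Icc 0 t, 0 < g s
  · obtain ⟨s, hs, hg⟩ := hc
    apply le_max_of_le_right
    have hsub : Icc t 1 ⊆ Icc 0 1 := Icc_subset_Icc_left ht.1
    have : MonotoneOn f (Icc t 1) := by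
      apply monotoneOn_of_deriv_nonneg (convex_Icc _ _) (hcf.mono hsub)
        (fun r hr => (hf r (hsub (interior_subset hr))).differentiableAt.differentiableWithinAt)
      intro r hr
      have hr := interior_subset hr
      rw [(hf r (hsub hr)).deriv]
      exact (ode_up h1 h2 ⟨hs.1, hs.2.trans ht.2⟩ (hsub hr) (hs.2.trans hr.1) hg).le
    exact this ⟨le_rfl, ht.2⟩ ⟨ht.2, le_rfl⟩ ht.2
  · push Not at hc
    apply le_max_of_le_left
    have hsub : Icc 0 t ⊆ Icc 0 1 := Icc_subset_Icc_right ht.2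
    have : AntitoneOn f (Icc 0 t) := by
      apply antitoneOn_of_deriv_nonpos (convex_Icc _ _) (hcf.mono hsub)
        (fun r hr => (hf r (hsub (interior_subset hr))).differentiableAt.differentiableWithinAt)
      intro r hr
      have hr := interior_subset hr
      rw [(hf r (hsub hr)).deriv]
      exact hc r hr
    exact this ⟨le_rfl, ht.1⟩ ⟨ht.1, le_rfl⟩ ht.1

lemma qc_min {f g g2 : ℝ → ℝ} (hf : ∀ t ∈ Icc (0:ℝ) 1, HasDerivAt f (g t) t)
    (h1 : ∀ t ∈ Icc (0:ℝ) 1, HasDerivAt g (g2 t) t)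
    (h2 : ∀ t ∈ Icc (0:ℝ) 1, g t = 0 → ∃ L, ∀ᶠ s in 𝓝 t, -L * |g s| ≤ g2 s)
    {t1 : ℝ} (ht1 : t1 ∈ Icc (0:ℝ) 1) (hg : g t1 = 0) : f t1 ≤ f 1 := by
  have hcf : ContinuousOn f (Icc 0 1) := fun t ht => (hf t ht).continuousAt.continuousWithinAt
  have hsub : Icc t1 1 ⊆ Icc 0 1 := Icc_subset_Icc_left ht1.1
  have : MonotoneOn f (Icc t1 1) := by
    apply monotoneOn_of_deriv_nonneg (convex_Icc _ _) (hcf.mono hsub)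
      (fun r hr => (hf r (hsub (interior_subset hr))).differentiableAt.differentiableWithinAt)
    intro r hr
    have hr := interior_subset hr
    rw [(hf r (hsub hr)).deriv]
    by_contra hn
    push Not at hn
    have := ode_down h1 h2 ht1 (hsub hr) hr.1 hn
    linarith
  exact this ⟨le_rfl, ht1.2⟩ ⟨ht1.2, le_rfl⟩ ht1.2

end real

section segest
variable {n : ℕ} {c : Euc n → Euc n → ℝ} {U V : Set (Euc n)}

/-- first derivative of `s ↦ -c(x(s),y)+c(x(s),ȳ)` along the segment -/
lemma seg_f1 (h0 : B0cond n c U V) (h1 : B1cond n c U V) {yb y : Euc n} (hyb : yb ∈ V) (hy : y ∈ V)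
    {q e : Euc n} {t : ℝ} (ht : q + t • e ∈ Uyset n c U yb) (γ : ℝ → Euc n)
    (hγ : γ = fun s : ℝ => xOf n c U yb (q + s • e)) :
    HasDerivAt (fun s => -c (γ s) y + c (γ s) yb)
      (-dd (deriv γ t, 0) (Function.uncurry c) (γ t, y) +
        dd (deriv γ t, 0) (Function.uncurry c) (γ t, yb)) t := by
  have hU : γ t ∈ U := by rw [hγ]; exact (chart h0 h1 hyb ht).1
  have hs : DifferentiableAt ℝ γ t := by
    rw [hγ]; exact (seg_smooth h0 h1 hyb ht).differentiableAt (by norm_num)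
  exact (comp_x1 (openO h0) (by omega) (smoothO h0) hs ⟨hU, hy⟩).neg.add
    (comp_x1 (openO h0) (by omega) (smoothO h0) hs ⟨hU, hyb⟩)

lemma seg_f2 (h0 : B0cond n c U V) (h1 : B1cond n c U V) {yb y : Euc n} (hyb : yb ∈ V) (hy : y ∈ V)
    {q e : Euc n} {t : ℝ} (ht : q + t • e ∈ Uyset n c U yb) (γ : ℝ → Euc n)
    (hγ : γ = fun s : ℝ => xOf n c U yb (q + s • e)) :
    HasDerivAt (fun s => -dd (deriv γ s, 0) (Function.uncurry c) (γ s, y) +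
        dd (deriv γ s, 0) (Function.uncurry c) (γ s, yb))
      (-LL (deriv γ t, 0) (deriv (deriv γ) t, 0) (Function.uncurry c) (γ t, y) +
        LL (deriv γ t, 0) (deriv (deriv γ) t, 0) (Function.uncurry c) (γ t, yb)) t := by
  have hU : γ t ∈ U := by rw [hγ]; exact (chart h0 h1 hyb ht).1
  have hs : ContDiffAt ℝ 2 γ t := by
    rw [hγ]; exact (seg_smooth h0 h1 hyb ht).of_le (by norm_num)
  exact (comp_x2 (openO h0) (by omega) (smoothO h0) hs ⟨hU, hy⟩).neg.add
    (comp_x2 (openO h0) (by omega) (smoothO h0) hs ⟨hU, hyb⟩)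

lemma seg_local (h0 : B0cond n c U V) (h1 : B1cond n c U V) (h2 : B2cond n c U V)
    (hM : MTW n c U V False) {yb y : Euc n} (hyb : yb ∈ V) (hy : y ∈ V)
    {q e : Euc n} {t : ℝ} (ht : q + t • e ∈ Uyset n c U yb) (γ : ℝ → Euc n)
    (hγ : γ = fun s : ℝ => xOf n c U yb (q + s • e))
    (hz : -dd (deriv γ t, 0) (Function.uncurry c) (γ t, y) +
        dd (deriv γ t, 0) (Function.uncurry c) (γ t, yb) = 0) :
    ∃ L, ∀ᶠ s in 𝓝 t, -L * |-dd (deriv γ s, 0) (Function.uncurry c) (γ s, y) +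
        dd (deriv γ s, 0) (Function.uncurry c) (γ s, yb)| ≤
      -LL (deriv γ s, 0) (deriv (deriv γ) s, 0) (Function.uncurry c) (γ s, y) +
        LL (deriv γ s, 0) (deriv (deriv γ) s, 0) (Function.uncurry c) (γ s, yb) := by
  have hO := openO h0
  have hC := smoothO h0
  by_cases he : e = 0
  · refine ⟨0, Eventually.of_forall fun s => ?_⟩
    have hg : γ = fun _ => xOf n c U yb q := by rw [hγ]; funext s; simp [he]
    rw [hg]
    have hz0 : ∀ L : Euc n × Euc n →L[ℝ] ℝ, L (0, 0) = 0 := fun L => map_zero L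
    simp [LL, dd, hz0]
  have hU : γ t ∈ U := by rw [hγ]; exact (chart h0 h1 hyb ht).1
  have hs : ContDiffAt ℝ 3 γ t := by rw [hγ]; exact seg_smooth h0 h1 hyb ht
  have hevU : ∀ᶠ s in 𝓝 t, γ s ∈ U ∧
      ∀ ζ, LL (deriv γ s, 0) (deriv (deriv γ) s, 0) (dd (0, ζ) (Function.uncurry c)) (γ s, yb) = 0 := by
    filter_upwards [seg_ev h0 h1 hyb ht] with s hs
    rw [hγ]
    exact ⟨(chart h0 h1 hyb hs).1, seg_acc h0 h1 hyb hs⟩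
  have hξ : deriv γ t ≠ 0 := by
    intro h
    have := seg_vel h0 h1 hyb ht e
    rw [← hγ, h] at this
    simp only [dd, Prod.mk_zero_zero, map_zero] at this
    rw [eq_comm, neg_eq_zero, inner_self_eq_zero] at this
    exact he this
  obtain ⟨E, -, hE⟩ := mixed h0 h1 hU hy
  set v := E (deriv γ t) with hv
  have hv0 : v ≠ 0 := by simpa [hv] using hξ
  set C := Function.uncurry c with hCdef
  set G := dd (0, v) C with hG
  have hGs : ContDiffOn ℝ ((3:ℕ)) G (U ×ˢ V) := dd_contDiffOn hO 3 rfl hC _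
  -- continuity of derivative curves
  have cγ : ContinuousAt γ t := hs.continuousAt
  have cγ1' : ContDiffAt ℝ 1 (fderiv ℝ γ) t := hs.fderiv_right (by norm_num)
  have cγ1 : ContDiffAt ℝ 2 (deriv γ) t := by
    have : ContDiffAt ℝ 2 (fderiv ℝ γ) t := hs.fderiv_right (by norm_num)
    exact this.clm_apply contDiffAt_const
  have cγ2 : ContDiffAt ℝ 1 (deriv (deriv γ)) t := by
    have : ContDiffAt ℝ 1 (fderiv ℝ (deriv γ)) t := cγ1.fderiv_right (by norm_num)
    exact this.clm_apply contDiffAt_const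
  have cP : ContinuousAt (fun z : ℝ × ℝ => (γ z.1, y + z.2 • v)) (t, 0) := by
    refine ContinuousAt.prodMk ?_ (by fun_prop)
    exact ContinuousAt.comp (f := Prod.fst) (g := γ) (x := (t, (0:ℝ))) cγ continuousAt_fst
  have cW : ContinuousAt (fun z : ℝ × ℝ => ((deriv γ z.1, 0) : Euc n × Euc n)) (t, 0) := by
    refine ContinuousAt.prodMk ?_ continuousAt_const
    exact ContinuousAt.comp (f := Prod.fst) (g := deriv γ) (x := (t, (0:ℝ))) cγ1.continuousAt
      continuousAt_fst
  have cA : ContinuousAt (fun z : ℝ × ℝ => ((deriv (deriv γ) z.1, 0) : Euc n × Euc n)) (t, 0) := by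
    refine ContinuousAt.prodMk ?_ continuousAt_const
    exact ContinuousAt.comp (f := Prod.fst) (g := deriv (deriv γ)) (x := (t, (0:ℝ)))
      cγ2.continuousAt continuousAt_fst
  have hP0 : (γ t, y + (0:ℝ) • v) ∈ U ×ˢ V := by simpa using ⟨hU, hy⟩
  have hPev : ∀ᶠ z : ℝ × ℝ in 𝓝 (t, 0), (γ z.1, y + z.2 • v) ∈ U ×ˢ V :=
    cP.preimage_mem_nhds (hO.mem_nhds hP0)
  have hDmu : ∀ {F : Euc n × Euc n → ℝ} {m : ℕ}, 1 ≤ m → ContDiffOn ℝ m F (U ×ˢ V) →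
      ∀ {x : Euc n} {μ : ℝ}, (x, y + μ • v) ∈ U ×ˢ V →
      HasDerivAt (fun s : ℝ => F (x, y + s • v)) (dd (0, v) F (x, y + μ • v)) μ := by
    intro F m hm hF x μ hx
    have hd : HasDerivAt (fun s : ℝ => y + s • v) v μ := by
      have h9 := ((hasDerivAt_id μ).smul_const v).const_add y
      exact HasDerivAt.congr_deriv h9 (by simp)
    have := comp_y1 hO hm hF (γ := fun s : ℝ => y + s • v) hd.differentiableAt hx
    rwa [hd.deriv] at this
  have key := local_est (t0 := t)
    (φ := fun s μ => dd (deriv γ s, 0) C (γ s, y + μ • v) - dd (deriv γ s, 0) C (γ s, yb))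
    (φμ := fun s μ => dd (deriv γ s, 0) G (γ s, y + μ • v))
    (T := fun s μ => LL (deriv γ s, 0) (deriv (deriv γ) s, 0) C (γ s, y + μ • v))
    (Tμ := fun s μ => LL (deriv γ s, 0) (deriv (deriv γ) s, 0) G (γ s, y + μ • v))
    (T0 := fun s => LL (deriv γ s, 0) (deriv (deriv γ) s, 0) C (γ s, yb))
    ?_ ?_ ?_ ?_ ?_ ?_ ?_ ?_
  · obtain ⟨L, hL⟩ := key
    refine ⟨L, ?_⟩
    filter_upwards [hL] with s hs
    simp only [zero_smul, add_zero] at hs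
    rw [← abs_neg, neg_add, neg_neg, ← sub_eq_add_neg]
    linarith
  · filter_upwards [hPev] with z hz
    have := (hDmu (m := 3) (by omega) (dd_contDiffOn hO 3 rfl hC (deriv γ z.1, 0)) hz).sub_const
      (dd (deriv γ z.1, 0) C (γ z.1, yb))
    rw [hG, dd_comm hO (by omega) hC _ _ hz]
    exact this
  · filter_upwards [hPev] with z hz
    rw [hG, LL_dd_comm hO (by omega) hC _ _ _ hz]
    exact hDmu (m := 2) (by omega) (LL_contDiffOn hO 2 rfl hC _ _) hz
  · have c1 : ContinuousAt (fderiv ℝ G) (γ t, y + (0:ℝ) • v) :=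
      ((hGs.contDiffAt (hO.mem_nhds hP0)).fderiv_right (m := 2) (by norm_num)).continuousAt
    have c2 : ContinuousAt (fun z : ℝ × ℝ => fderiv ℝ G (γ z.1, y + z.2 • v)) (t, 0) :=
      ContinuousAt.comp (f := fun z : ℝ × ℝ => (γ z.1, y + z.2 • v)) (g := fderiv ℝ G) c1 cP
    exact c2.clm_apply cW
  · have d1 : ContDiffAt ℝ 2 (fderiv ℝ G) (γ t, y + (0:ℝ) • v) :=
      ((hGs.contDiffAt (hO.mem_nhds hP0)).fderiv_right (m := 2) (by norm_num))
    have c1 := d1.continuousAt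
    have c1' : ContinuousAt (fderiv ℝ (fderiv ℝ G)) (γ t, y + (0:ℝ) • v) :=
      (d1.fderiv_right (m := 1) (by norm_num)).continuousAt
    have c2 : ContinuousAt (fun z : ℝ × ℝ => fderiv ℝ G (γ z.1, y + z.2 • v)) (t, 0) :=
      ContinuousAt.comp (f := fun z : ℝ × ℝ => (γ z.1, y + z.2 • v)) (g := fderiv ℝ G) c1 cP
    have c2' : ContinuousAt (fun z : ℝ × ℝ => fderiv ℝ (fderiv ℝ G) (γ z.1, y + z.2 • v)) (t, 0) :=
      ContinuousAt.comp (f := fun z : ℝ × ℝ => (γ z.1, y + z.2 • v)) (g := fderiv ℝ (fderiv ℝ G))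
        c1' cP
    have c3 := ((c2'.clm_apply cW).clm_apply cW).add (c2.clm_apply cA)
    refine c3.congr ?_
    filter_upwards [hPev] with z hz
    unfold LL
    rw [dd_dd hO (m := 3) (by omega) hGs _ _ hz]
    rfl
  · have d := (seg_f2 h0 h1 hyb hy ht γ hγ).continuousAt.neg
    refine d.congr (Eventually.of_forall fun s => ?_)
    simp only [zero_smul, add_zero, ← hCdef, Pi.neg_apply]
    ring
  · simp only [zero_smul, add_zero]; linarith
  · simp only [zero_smul, add_zero]
    rw [hG, hE]
    exact real_inner_self_pos.2 hv0
  · have h3 : ∀ᶠ z : ℝ × ℝ in 𝓝 (t, 0), γ z.1 ∈ U ∧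
      ∀ ζ, LL (deriv γ z.1, 0) (deriv (deriv γ) z.1, 0) (dd (0, ζ) C) (γ z.1, yb) = 0 :=
      (continuousAt_fst : ContinuousAt Prod.fst (t, (0:ℝ))).eventually hevU
    filter_upwards [hPev, h3] with z hz h3 h4
    exact keyK h0 h1 h2 hM h3.1 hyb hz.2 h3.2 (Or.inr (by linarith))

end segest

section loeper
variable {n : ℕ} {c : Euc n → Euc n → ℝ} {U V : Set (Euc n)}

lemma cont_c (h0 : B0cond n c U V) : ContinuousOn (Function.uncurry c) (closure U ×ˢ closure V) :=
  h0.2.2.2.2.continuousOn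

lemma xOf_grad (h1 : B1cond n c U V) {x y : Euc n} (hx : x ∈ closure U) (hy : y ∈ closure V) :
    xOf n c U y (-gradY n c x y) = x :=
  invFunOn_apply (f := fun x => -gradY n c x y) (h1.1 y hy).1 hx

lemma int_loeper (h0 : B0cond n c U V) (h1 : B1cond n c U V) (h2 : B2cond n c U V)
    (hM : MTW n c U V False) {yb y : Euc n} (hyb : yb ∈ V) (hy : y ∈ V)
    {q e : Euc n} (hq : ∀ t ∈ Icc (0:ℝ) 1, q + t • e ∈ Uyset n c U yb) (γ : ℝ → Euc n)
    (hγ : γ = fun s : ℝ => xOf n c U yb (q + s • e)) {t : ℝ} (ht : t ∈ Icc (0:ℝ) 1) :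
    -c (γ t) y + c (γ t) yb ≤ max (-c (γ 0) y + c (γ 0) yb) (-c (γ 1) y + c (γ 1) yb) :=
  qc_max (f := fun t => -c (γ t) y + c (γ t) yb)
    (fun t ht => seg_f1 h0 h1 hyb hy (hq t ht) γ hγ)
    (fun t ht => seg_f2 h0 h1 hyb hy (hq t ht) γ hγ)
    (fun t ht hz => seg_local h0 h1 h2 hM hyb hy (hq t ht) γ hγ hz) ht

lemma int_min (h0 : B0cond n c U V) (h1 : B1cond n c U V) (h2 : B2cond n c U V)
    (hM : MTW n c U V False) {yb y : Euc n} (hyb : yb ∈ V) (hy : y ∈ V)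
    {q e : Euc n} (hq : ∀ t ∈ Icc (0:ℝ) 1, q + t • e ∈ Uyset n c U yb) (γ : ℝ → Euc n)
    (hγ : γ = fun s : ℝ => xOf n c U yb (q + s • e)) {t : ℝ} (ht : t ∈ Icc (0:ℝ) 1)
    (hz : -dd (deriv γ t, 0) (Function.uncurry c) (γ t, y) +
        dd (deriv γ t, 0) (Function.uncurry c) (γ t, yb) = 0) :
    -c (γ t) y + c (γ t) yb ≤ -c (γ 1) y + c (γ 1) yb :=
  qc_min (f := fun t => -c (γ t) y + c (γ t) yb)
    (fun t ht => seg_f1 h0 h1 hyb hy (hq t ht) γ hγ)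
    (fun t ht => seg_f2 h0 h1 hyb hy (hq t ht) γ hγ)
    (fun t ht hz => seg_local h0 h1 h2 hM hyb hy (hq t ht) γ hγ hz) ht hz

lemma int_convex (h0 : B0cond n c U V) (h1 : B1cond n c U V) (h2 : B2cond n c U V)
    (hM : MTW n c U V True) {yb y : Euc n} (hyb : yb ∈ V) (hy : y ∈ V)
    {q e : Euc n} (hq : ∀ t ∈ Icc (0:ℝ) 1, q + t • e ∈ Uyset n c U yb) (γ : ℝ → Euc n)
    (hγ : γ = fun s : ℝ => xOf n c U yb (q + s • e)) {t : ℝ} (ht : t ∈ Icc (0:ℝ) 1) :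
    -c (γ t) y + c (γ t) yb ≤ (1 - t) * (-c (γ 0) y + c (γ 0) yb) +
      t * (-c (γ 1) y + c (γ 1) yb) := by
  have d1 := fun t ht => seg_f1 h0 h1 hyb hy (hq t ht) γ hγ
  have d2 := fun t ht => seg_f2 h0 h1 hyb hy (hq t ht) γ hγ
  have hi : interior (Icc (0:ℝ) 1) ⊆ Icc 0 1 := interior_subset
  have hm : MonotoneOn (fun s => -dd (deriv γ s, 0) (Function.uncurry c) (γ s, y) +
        dd (deriv γ s, 0) (Function.uncurry c) (γ s, yb)) (Icc 0 1) := by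
    apply monotoneOn_of_deriv_nonneg (convex_Icc 0 1)
      (fun t ht => (d2 t ht).continuousAt.continuousWithinAt)
      (fun t ht => (d2 t (hi ht)).differentiableAt.differentiableWithinAt)
    intro s hs
    rw [(d2 s (hi hs)).deriv]
    have hU : γ s ∈ U := by rw [hγ]; exact (chart h0 h1 hyb (hq s (hi hs))).1
    have := keyK h0 h1 h2 hM hU hyb hy (ξ := deriv γ s) (a := deriv (deriv γ) s)
      (by rw [hγ]; exact seg_acc h0 h1 hyb (hq s (hi hs))) (Or.inl trivial)
    linarith
  have hconv : ConvexOn ℝ (Icc (0:ℝ) 1) (fun t => -c (γ t) y + c (γ t) yb) := by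
    apply MonotoneOn.convexOn_of_deriv (convex_Icc 0 1)
      (fun t ht => (d1 t ht).continuousAt.continuousWithinAt)
      (fun t ht => (d1 t (hi ht)).differentiableAt.differentiableWithinAt)
    refine (hm.mono hi).congr fun s hs => ?_
    exact ((d1 s (hi hs)).deriv).symm
  have := hconv.2 (left_mem_Icc.2 zero_le_one) (right_mem_Icc.2 zero_le_one)
    (sub_nonneg.2 ht.2) ht.1 (sub_add_cancel 1 t)
  simpa using this

lemma closure_limit (h0 : B0cond n c U V) (h1 : B1cond n c U V) (h2 : B2cond n c U V)
    {t : ℝ} (ht : t ∈ Icc (0:ℝ) 1) {R : Set (ℝ × ℝ × ℝ)} (hR : IsClosed R)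
    (hinter : ∀ yb ∈ V, ∀ y ∈ V, ∀ x0 ∈ U, ∀ x1 ∈ U, ∀ xt ∈ U,
      -gradY n c xt yb = -gradY n c x0 yb + t • (-gradY n c x1 yb - -gradY n c x0 yb) →
      (-c x0 y + c x0 yb, -c x1 y + c x1 yb, -c xt y + c xt yb) ∈ R)
    {yb y x0 x1 : Euc n} (hyb : yb ∈ closure V) (hy : y ∈ closure V) (hx0 : x0 ∈ closure U)
    (hx1 : x1 ∈ closure U) : ∃ xt ∈ closure U,
      -gradY n c xt yb = -gradY n c x0 yb + t • (-gradY n c x1 yb - -gradY n c x0 yb) ∧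
      (-c x0 y + c x0 yb, -c x1 y + c x1 yb, -c xt y + c xt yb) ∈ R := by
  obtain ⟨a0, ha0, la0⟩ := mem_closure_iff_seq_limit.1 hx0
  obtain ⟨a1, ha1, la1⟩ := mem_closure_iff_seq_limit.1 hx1
  obtain ⟨b, hb, lb⟩ := mem_closure_iff_seq_limit.1 hyb
  obtain ⟨d, hd, ld⟩ := mem_closure_iff_seq_limit.1 hy
  have hex : ∀ k, ∃ x ∈ U, -gradY n c x (b k) =
      -gradY n c (a0 k) (b k) + t • (-gradY n c (a1 k) (b k) - -gradY n c (a0 k) (b k)) := by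
    intro k
    exact seg_mem (h2.1 (b k) (subset_closure (hb k))) ⟨a0 k, ha0 k, rfl⟩ ⟨a1 k, ha1 k, rfl⟩ ht
  choose xs hxs hgs using hex
  obtain ⟨xt, hxt, φ, hφ, lxt⟩ := h0.2.1.isCompact_closure.tendsto_subseq
    (fun k => subset_closure (hxs k))
  have hG := contGY h0 h1 h2 ⟨_, ha0 0⟩ ⟨_, hb 0⟩
  have la0 := la0.comp hφ.tendsto_atTop
  have la1 := la1.comp hφ.tendsto_atTop
  have lb := lb.comp hφ.tendsto_atTop
  have ld := ld.comp hφ.tendsto_atTop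
  have lim2 : ∀ {X : Type} [TopologicalSpace X] {F : Euc n × Euc n → X},
      ContinuousOn F (closure U ×ˢ closure V) →
      ∀ {p q : Euc n} {ps qs : ℕ → Euc n}, p ∈ closure U → q ∈ closure V → (∀ k, ps k ∈ U) →
      (∀ k, qs k ∈ V) → Tendsto ps atTop (𝓝 p) → Tendsto qs atTop (𝓝 q) →
      Tendsto (fun k => F (ps k, qs k)) atTop (𝓝 (F (p, q))) := by
    intro X _ F hF p q ps qs hp hq hps hqs lp lq
    have hc := hF (p, q) ⟨hp, hq⟩
    refine hc.tendsto.comp (tendsto_nhdsWithin_iff.2 ⟨lp.prodMk_nhds lq, ?_⟩)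
    exact Eventually.of_forall fun k => ⟨subset_closure (hps k), subset_closure (hqs k)⟩
  have cc := cont_c h0
  refine ⟨xt, hxt, ?_, ?_⟩
  · have g0 := lim2 hG hx0 hyb (fun k => ha0 (φ k)) (fun k => hb (φ k)) la0 lb
    have g1 := lim2 hG hx1 hyb (fun k => ha1 (φ k)) (fun k => hb (φ k)) la1 lb
    have gt := lim2 hG hxt hyb (fun k => hxs (φ k)) (fun k => hb (φ k)) lxt lb
    refine tendsto_nhds_unique gt.neg ?_
    have := g0.neg.add ((g1.neg.sub g0.neg).const_smul t)
    refine this.congr fun k => ?_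
    exact (hgs (φ k)).symm
  · have key : ∀ {p : Euc n} {ps : ℕ → Euc n}, p ∈ closure U → (∀ k, ps k ∈ U) →
        Tendsto ps atTop (𝓝 p) →
        Tendsto (fun k => -c (ps k) (d (φ k)) + c (ps k) (b (φ k))) atTop
          (𝓝 (-c p y + c p yb)) := by
      intro p ps hp hps lp
      exact (lim2 cc hp hy hps (fun k => hd (φ k)) lp ld).neg.add
        (lim2 cc hp hyb hps (fun k => hb (φ k)) lp lb)
    have k0 := key hx0 (fun k => ha0 (φ k)) la0
    have k1 := key hx1 (fun k => ha1 (φ k)) la1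
    have k2 := key hxt (fun k => hxs (φ k)) lxt
    refine hR.mem_of_tendsto (k0.prodMk_nhds (k1.prodMk_nhds k2)) (Eventually.of_forall fun k => ?_)
    exact hinter _ (hb _) _ (hd _) _ (ha0 _) _ (ha1 _) _ (hxs _) (hgs _)

/-- Loeper's maximum principle up to the boundary -/
lemma loeper (h0 : B0cond n c U V) (h1 : B1cond n c U V) (h2 : B2cond n c U V)
    (hM : MTW n c U V False) {t : ℝ} (ht : t ∈ Icc (0:ℝ) 1)
    {yb y x0 x1 : Euc n} (hyb : yb ∈ closure V) (hy : y ∈ closure V) (hx0 : x0 ∈ closure U)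
    (hx1 : x1 ∈ closure U) : ∃ xt ∈ closure U,
      -gradY n c xt yb = -gradY n c x0 yb + t • (-gradY n c x1 yb - -gradY n c x0 yb) ∧
      -c xt y + c xt yb ≤ max (-c x0 y + c x0 yb) (-c x1 y + c x1 yb) := by
  refine closure_limit h0 h1 h2 ht (R := {r | r.2.2 ≤ max r.1 r.2.1})
    (isClosed_le (by fun_prop) (by fun_prop)) ?_ hyb hy hx0 hx1
  intro yb hyb y hy x0 hx0 x1 hx1 xt hxt he
  have hS : ∀ {x}, x ∈ U → x ∈ closure U := fun h => subset_closure h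
  have := int_loeper h0 h1 h2 hM hyb hy (q := -gradY n c x0 yb)
    (e := -gradY n c x1 yb - -gradY n c x0 yb)
    (fun t ht => seg_mem (h2.1 yb (subset_closure hyb)) ⟨x0, hx0, rfl⟩ ⟨x1, hx1, rfl⟩ ht) _ rfl ht
  rw [← he, xOf_grad h1 (hS hxt) (subset_closure hyb), zero_smul, add_zero, one_smul,
    add_sub_cancel, xOf_grad h1 (hS hx0) (subset_closure hyb),
    xOf_grad h1 (hS hx1) (subset_closure hyb)] at this
  exact this

lemma loeper_conv (h0 : B0cond n c U V) (h1 : B1cond n c U V) (h2 : B2cond n c U V)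
    (hM : MTW n c U V True) {t : ℝ} (ht : t ∈ Icc (0:ℝ) 1)
    {yb y x0 x1 : Euc n} (hyb : yb ∈ closure V) (hy : y ∈ closure V) (hx0 : x0 ∈ closure U)
    (hx1 : x1 ∈ closure U) : ∃ xt ∈ closure U,
      -gradY n c xt yb = -gradY n c x0 yb + t • (-gradY n c x1 yb - -gradY n c x0 yb) ∧
      -c xt y + c xt yb ≤ (1 - t) * (-c x0 y + c x0 yb) + t * (-c x1 y + c x1 yb) := by
  refine closure_limit h0 h1 h2 ht (R := {r | r.2.2 ≤ (1 - t) * r.1 + t * r.2.1})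
    (isClosed_le (by fun_prop) (by fun_prop)) ?_ hyb hy hx0 hx1
  intro yb hyb y hy x0 hx0 x1 hx1 xt hxt he
  have hS : ∀ {x}, x ∈ U → x ∈ closure U := fun h => subset_closure h
  have := int_convex h0 h1 h2 hM hyb hy (q := -gradY n c x0 yb)
    (e := -gradY n c x1 yb - -gradY n c x0 yb)
    (fun t ht => seg_mem (h2.1 yb (subset_closure hyb)) ⟨x0, hx0, rfl⟩ ⟨x1, hx1, rfl⟩ ht) _ rfl ht
  rw [← he, xOf_grad h1 (hS hxt) (subset_closure hyb), zero_smul, add_zero, one_smul,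
    add_sub_cancel, xOf_grad h1 (hS hx0) (subset_closure hyb),
    xOf_grad h1 (hS hx1) (subset_closure hyb)] at this
  exact this

lemma hasDeriv_c (h0 : B0cond n c U V) {y : Euc n} (hy : y ∈ closure V) {γ : ℝ → Euc n} {t : ℝ}
    (hγ : DifferentiableAt ℝ γ t) (ht : γ t ∈ U) :
    HasDerivAt (fun s => c (γ s) y) (inner ℝ (gradX n c (γ t) y) (deriv γ t)) t := by
  have hd : DifferentiableAt ℝ (fun x => c x y) (γ t) := by
    have h3 : ContDiffOn ℝ 4 (fun x => c x y) U :=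
      h0.2.2.2.2.comp (f := fun x : Euc n => (x, y)) (by fun_prop)
        (fun x hx => ⟨subset_closure hx, hy⟩)
    exact (h3.contDiffAt (h0.1.mem_nhds ht)).differentiableAt (by norm_num)
  have := hd.hasGradientAt.hasFDerivAt.comp_hasDerivAt t hγ.hasDerivAt
  exact this

lemma bdry_min (h0 : B0cond n c U V) (h1 : B1cond n c U V) (h2 : B2cond n c U V)
    (hM : MTW n c U V False) {yb y : Euc n} (hyb : yb ∈ V) (hy : y ∈ closure V)
    {q e : Euc n} (hq : ∀ t ∈ Icc (0:ℝ) 1, q + t • e ∈ Uyset n c U yb) (γ : ℝ → Euc n)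
    (hγ : γ = fun s : ℝ => xOf n c U yb (q + s • e)) {t : ℝ} (ht : t ∈ Ioo (0:ℝ) 1)
    (hmax : ∀ s ∈ Icc (0:ℝ) 1, -c (γ s) y + c (γ s) yb ≤ -c (γ t) y + c (γ t) yb) :
    -c (γ t) y + c (γ t) yb ≤ -c (γ 1) y + c (γ 1) yb := by
  have ht' : t ∈ Icc (0:ℝ) 1 := Ioo_subset_Icc_self ht
  have hU : ∀ s ∈ Icc (0:ℝ) 1, γ s ∈ U := fun s hs => by
    rw [hγ]; exact (chart h0 h1 hyb (hq s hs)).1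
  have hs : DifferentiableAt ℝ γ t := by
    rw [hγ]; exact (seg_smooth h0 h1 hyb (hq t ht')).differentiableAt (by norm_num)
  set x := γ t with hx
  have hxU : x ∈ U := hU t ht'
  have hxc : x ∈ closure U := subset_closure hxU
  set pb := -gradX n c x yb with hpb
  set p := -gradX n c x y with hp
  have hD := (hasDeriv_c h0 hy hs hxU).neg.add (hasDeriv_c h0 (subset_closure hyb) hs hxU)
  have hz : -inner ℝ (gradX n c x y) (deriv γ t) + inner ℝ (gradX n c x yb) (deriv γ t) = 0 := by
    refine IsLocalMax.hasDerivAt_eq_zero ?_ hD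
    filter_upwards [Icc_mem_nhds ht.1 ht.2] with s hs
    exact hmax s hs
  have hdiff := h1.2 x hxc
  have hopen : IsOpen (Vxset n c V x) := diffeo_open h0.2.2.1 hdiff
  have hclos : (fun y => -gradX n c x y) '' closure V = closure (Vxset n c V x) :=
    diffeo_closure h0.2.2.2.1 hdiff
  have hpc : p ∈ closure (Vxset n c V x) := hclos ▸ ⟨y, hy, rfl⟩
  have hpbm : pb ∈ Vxset n c V x := ⟨yb, hyb, rfl⟩
  have hmem : ∀ s ∈ Ico (0:ℝ) 1, pb + s • (p - pb) ∈ Vxset n c V x := by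
    intro s hs
    have := (h2.2 x hxc).combo_interior_closure_mem_interior (x := pb) (y := p) (a := 1 - s) (b := s)
      (by rwa [hopen.interior_eq]) hpc (by linarith [hs.2]) hs.1 (by ring)
    rw [hopen.interior_eq] at this
    convert this using 1
    rw [smul_sub, sub_smul, one_smul]; abel
  have hineq : ∀ s ∈ Ico (0:ℝ) 1,
      -c x (yOf n c V x (pb + s • (p - pb))) + c x yb ≤
      -c (γ 1) (yOf n c V x (pb + s • (p - pb))) + c (γ 1) yb := by
    intro s hs
    obtain ⟨m1, m2, -⟩ := ychart h0 h1 hxU (hmem s hs)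
    refine int_min h0 h1 h2 hM hyb m1 hq γ hγ ht' ?_
    rw [← hx, ← inner_gradX h0 hxU m1, ← inner_gradX h0 hxU hyb,
      ← neg_neg (gradX n c x (yOf n c V x (pb + s • (p - pb)))), m2, hpb, hp]
    simp only [inner_add_left, inner_neg_left, inner_smul_left, inner_sub_left]
    simp only [conj_trivial]
    linear_combination s * hz
  have hcy : ContinuousOn (yOf n c V x) (closure (Vxset n c V x)) := by
    rw [← hclos]; exact hdiff.2.2.continuousOn
  have hy1 : yOf n c V x p = y := invFunOn_apply hdiff.1 hy
  have hlim : Tendsto (fun s : ℝ => yOf n c V x (pb + s • (p - pb))) (𝓝[<] 1) (𝓝[closure V] y) := by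
    refine tendsto_nhdsWithin_iff.2 ⟨?_, ?_⟩
    · have h3 := hcy p hpc
      rw [ContinuousWithinAt, hy1] at h3
      refine h3.comp (tendsto_nhdsWithin_iff.2 ⟨?_, ?_⟩)
      · have : ContinuousAt (fun s : ℝ => pb + s • (p - pb)) 1 := by fun_prop
        have h4 : Tendsto (fun s : ℝ => pb + s • (p - pb)) (𝓝 1) (𝓝 p) := by
          convert this.tendsto using 2
          simp
        exact h4.mono_left nhdsWithin_le_nhds
      · filter_upwards [Ioo_mem_nhdsLT (zero_lt_one (α := ℝ))] with s hs
        exact subset_closure (hmem s ⟨hs.1.le, hs.2⟩)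
    · filter_upwards [Ioo_mem_nhdsLT (zero_lt_one (α := ℝ))] with s hs
      exact subset_closure (ychart h0 h1 hxU (hmem s ⟨hs.1.le, hs.2⟩)).1
  have hcl : ∀ {z}, z ∈ U → Tendsto (fun s : ℝ => c z (yOf n c V x (pb + s • (p - pb)))) (𝓝[<] 1)
      (𝓝 (c z y)) := by
    intro z hz
    have h3 : ContinuousOn (fun y => c z y) (closure V) :=
      (cont_c h0).comp (f := fun y => (z, y)) (by fun_prop) (fun y hy => ⟨subset_closure hz, hy⟩)
    exact (h3 y hy).tendsto.comp hlim
  refine le_of_tendsto_of_tendsto ((hcl hxU).neg.add_const (c x yb))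
    ((hcl (hU 1 (by simp))).neg.add_const (c (γ 1) yb)) ?_
  filter_upwards [Ioo_mem_nhdsLT (zero_lt_one (α := ℝ))] with s hs
  exact hineq s ⟨hs.1.le, hs.2⟩

end loeper

section cconv
variable {n : ℕ} {c : Euc n → Euc n → ℝ} {U V : Set (Euc n)} {u : Euc n → ℝ}

lemma contY (h0 : B0cond n c U V) {z : Euc n} (hz : z ∈ closure U) :
    ContinuousOn (fun y => c z y) (closure V) :=
  (cont_c h0).comp (f := fun y => (z, y)) (by fun_prop) (fun _ hy => ⟨hz, hy⟩)

lemma contX (h0 : B0cond n c U V) {y : Euc n} (hy : y ∈ closure V) :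
    ContinuousOn (fun z => c z y) (closure U) :=
  (cont_c h0).comp (f := fun z => (z, y)) (by fun_prop) (fun _ hz => ⟨hz, hy⟩)

lemma cpt (h0 : B0cond n c U V) : IsCompact (closure U ×ˢ closure V) :=
  h0.2.1.isCompact_closure.prod h0.2.2.2.1.isCompact_closure

lemma supp_exists (h0 : B0cond n c U V) (hV : V.Nonempty)
    (hu : CConvexOn n c (closure U) (closure V) u) {x : Euc n} (hx : x ∈ closure U) :
    ∃ y ∈ closure V, ∀ z ∈ closure U, u x + c x y ≤ u z + c z y := by
  obtain ⟨B, hB⟩ := (cpt h0).exists_bound_of_continuousOn (cont_c h0)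
  have hB' : ∀ x ∈ closure U, ∀ y ∈ closure V, |c x y| ≤ B := fun x hx y hy => hB (x, y) ⟨hx, hy⟩
  obtain ⟨y0, hy0⟩ := hV.closure
  have hbelow : ∃ m, ∀ z ∈ closure U, m ≤ u z := by
    by_cases hc : ∃ y ∈ closure V, BddAbove ((fun x => -c x y - u x) '' closure U)
    · obtain ⟨y, hy, M, hM⟩ := hc
      refine ⟨-B - M, fun z hz => ?_⟩
      have h3 := hM ⟨z, hz, rfl⟩
      have h4 := abs_le.1 (hB' z hz y hy)
      simp only at h3
      linarith
    · push Not at hc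
      refine ⟨-B, fun z hz => ?_⟩
      have hw : ∀ y ∈ closure V, cStarT n c (closure U) u y = 0 := fun y hy =>
        Real.sSup_of_not_bddAbove (hc y hy)
      rw [hu z hz]
      have hbd : BddAbove ((fun y => -c z y - cStarT n c (closure U) u y) '' closure V) := by
        refine ⟨B, ?_⟩
        rintro _ ⟨y, hy, rfl⟩
        have h4 := abs_le.1 (hB' z hz y hy)
        simp only [hw y hy]; linarith
      have h4 := abs_le.1 (hB' z hz y0 hy0)
      refine le_trans ?_ (le_csSup hbd ⟨y0, hy0, rfl⟩)
      simp only [hw y0 hy0]; linarith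
  obtain ⟨m, hm⟩ := hbelow
  have hw : ∀ y ∈ closure V, ∀ z ∈ closure U, -c z y - u z ≤ cStarT n c (closure U) u y := by
    intro y hy z hz
    refine le_csSup ⟨B - m, ?_⟩ ⟨z, hz, rfl⟩
    rintro _ ⟨z, hz, rfl⟩
    have h4 := abs_le.1 (hB' z hz y hy)
    have := hm z hz
    simp only; linarith
  set S := (fun y => -c x y - cStarT n c (closure U) u y) '' closure V with hS
  have hlub : IsLUB S (u x) := by
    rw [hu x hx]
    refine isLUB_csSup (hV.closure.image _) ?_
    refine ⟨u x, ?_⟩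
    rintro _ ⟨y, hy, rfl⟩
    have := hw y hy x hx
    simp only; linarith
  obtain ⟨s, -, -, hs, hsS⟩ := hlub.exists_seq_monotone_tendsto (hV.closure.image _)
  choose ys hys hye using hsS
  obtain ⟨y, hy, φ, hφ, ly⟩ := h0.2.2.2.1.isCompact_closure.tendsto_subseq hys
  refine ⟨y, hy, fun z hz => ?_⟩
  have hcl : ∀ {z}, z ∈ closure U → Tendsto (fun k => c z (ys (φ k))) atTop (𝓝 (c z y)) := by
    intro z hz
    exact (contY h0 hz y hy).tendsto.comp (tendsto_nhdsWithin_iff.2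
      ⟨ly, Eventually.of_forall fun k => hys _⟩)
  have l1 : Tendsto (fun k => s (φ k)) atTop (𝓝 (u x)) := hs.comp hφ.tendsto_atTop
  refine le_of_tendsto_of_tendsto (l1.add (hcl hx)) ((hcl hz).const_add (u z))
    (Eventually.of_forall fun k => ?_)
  have h3 := hye (φ k)
  have h4 := hw (ys (φ k)) (hys _) z hz
  simp only at h3 ⊢
  linarith

lemma cont_u (h0 : B0cond n c U V) (hV : V.Nonempty)
    (hu : CConvexOn n c (closure U) (closure V) u) : ContinuousOn u (closure U) := by
  have huc := (cpt h0).uniformContinuousOn_of_continuous (cont_c h0)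
  rw [Metric.uniformContinuousOn_iff] at huc
  rw [Metric.continuousOn_iff]
  intro x hx ε hε
  obtain ⟨δ, hδ, h⟩ := huc ε hε
  refine ⟨δ, hδ, fun z hz hd => ?_⟩
  have key : ∀ x ∈ closure U, ∀ z ∈ closure U, dist z x < δ → u z - u x < ε := by
    intro x hx z hz hd
    obtain ⟨y, hy, hs⟩ := supp_exists h0 hV hu hz
    have h3 := h (z, y) ⟨hz, hy⟩ (x, y) ⟨hx, hy⟩ (by rw [Prod.dist_eq]; simpa using hd)
    rw [Real.dist_eq, abs_lt] at h3
    have h4 := hs x hx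
    simp only [Function.uncurry] at h3
    linarith [h3.1]
  rw [Real.dist_eq, abs_lt]
  have h5 := key x hx z hz hd
  have h6 := key z hz x hx (by rwa [dist_comm])
  constructor <;> linarith

lemma local_global (h0 : B0cond n c U V) (h1 : B1cond n c U V) (h2 : B2cond n c U V)
    (hM : MTW n c U V False) (hu : CConvexOn n c (closure U) (closure V) u)
    {xs y : Euc n} (hxs : xs ∈ U) (hy : y ∈ V)
    (hloc : ∀ᶠ x in 𝓝 xs, u xs + c xs y ≤ u x + c x y) :
    ∀ z ∈ closure U, u xs + c xs y ≤ u z + c z y := by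
  have hV : V.Nonempty := ⟨y, hy⟩
  have hyc : y ∈ closure V := subset_closure hy
  suffices hinter : ∀ z ∈ U, u xs + c xs y ≤ u z + c z y by
    intro z hz
    exact le_on_closure hinter continuousOn_const
      ((cont_u h0 hV hu).add (contX h0 hyc)) hz
  intro z hz
  set q := -gradY n c xs y with hq
  set e := -gradY n c z y - -gradY n c xs y with he
  have hmem : ∀ t ∈ Icc (0:ℝ) 1, q + t • e ∈ Uyset n c U y := fun t ht =>
    seg_mem (h2.1 y hyc) ⟨xs, hxs, rfl⟩ ⟨z, hz, rfl⟩ ht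
  set γ : ℝ → Euc n := fun s => xOf n c U y (q + s • e) with hγ
  have g0 : γ 0 = xs := by
    simp only [hγ, zero_smul, add_zero, hq]
    exact xOf_grad h1 (subset_closure hxs) hyc
  have g1 : γ 1 = z := by
    simp only [hγ, one_smul, hq, he, add_sub_cancel]
    exact xOf_grad h1 (subset_closure hz) hyc
  have hU : ∀ s ∈ Icc (0:ℝ) 1, γ s ∈ closure U := fun s hs =>
    subset_closure (chart h0 h1 hy (hmem s hs)).1
  have h00 : (0:ℝ) ∈ Icc (0:ℝ) 1 := by simp
  have h11 : (1:ℝ) ∈ Icc (0:ℝ) 1 := by simp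
  by_contra hcon
  push Not at hcon
  set k := u xs + c xs y with hk
  have hle : ∀ t ∈ Icc (0:ℝ) 1, u (γ t) + c (γ t) y ≤ k := by
    intro t ht
    obtain ⟨yt, hyt, hs⟩ := supp_exists h0 hV hu (hU t ht)
    obtain ⟨xt, hxt, e1, e2⟩ := loeper h0 h1 h2 hM ht hyc hyt (subset_closure hxs)
      (subset_closure hz)
    have e3 : γ t = xt := by
      simp only [hγ, hq, he]
      rw [← e1]; exact xOf_grad h1 hxt hyc
    rw [← e3] at e2
    have b0 := hs xs (subset_closure hxs)
    have b1 := hs z (subset_closure hz)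
    rcases le_max_iff.1 e2 with h | h <;> linarith
  have hc0 : ContinuousAt γ 0 := (seg_smooth h0 h1 hy (hmem 0 h00)).continuousAt
  have hev : ∀ᶠ t in 𝓝[>] (0:ℝ), k ≤ u (γ t) + c (γ t) y := by
    have : Tendsto γ (𝓝 0) (𝓝 xs) := by rw [← g0]; exact hc0
    exact nhdsWithin_le_nhds (this.eventually hloc)
  obtain ⟨t, ht1, ht⟩ := (hev.and (Ioo_mem_nhdsGT (zero_lt_one (α := ℝ)))).exists
  have ht' := Ioo_subset_Icc_self ht
  obtain ⟨y1, hy1, hs⟩ := supp_exists h0 hV hu (hU t ht')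
  have := bdry_min h0 h1 h2 hM hy hy1 hmem γ hγ ht (fun s hs' => by
    have := hle s hs'
    have := hs (γ s) (hU s hs')
    linarith)
  rw [g1] at this
  have := hs z (subset_closure hz)
  linarith

end cconv

section final
variable {n : ℕ} {c : Euc n → Euc n → ℝ} {U V : Set (Euc n)} {u : Euc n → ℝ}

lemma xOf_clUy {yb q : Euc n} (hq : q ∈ clUy n c U yb) :
    xOf n c U yb q ∈ closure U ∧ -gradY n c (xOf n c U yb q) yb = q :=
  ⟨Function.invFunOn_mem hq, Function.invFunOn_eq (f := fun x => -gradY n c x yb) hq⟩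

lemma xOf_cont (h1 : B1cond n c U V) {yb : Euc n} (hyb : yb ∈ closure V) :
    ContinuousOn (xOf n c U yb) (clUy n c U yb) := (h1.1 yb hyb).2.2.continuousOn

lemma clUy_compact (h0 : B0cond n c U V) (h1 : B1cond n c U V) {yb : Euc n}
    (hyb : yb ∈ closure V) : IsCompact (clUy n c U yb) :=
  h0.2.1.isCompact_closure.image_of_continuousOn (h1.1 yb hyb).2.1.continuousOn

lemma mod_loeper (h0 : B0cond n c U V) (h1 : B1cond n c U V) (h2 : B2cond n c U V)
    (hM : MTW n c U V False) {yb y q0 q1 : Euc n} (hyb : yb ∈ closure V) (hy : y ∈ closure V)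
    (hq0 : q0 ∈ clUy n c U yb) (hq1 : q1 ∈ clUy n c U yb) {a b : ℝ} (ha : 0 ≤ a) (hb : 0 ≤ b)
    (hab : a + b = 1) : a • q0 + b • q1 ∈ clUy n c U yb ∧
      -modCost n c U yb (a • q0 + b • q1) y ≤
        max (-modCost n c U yb q0 y) (-modCost n c U yb q1 y) := by
  obtain ⟨m0, e0⟩ := xOf_clUy hq0
  obtain ⟨m1, e1⟩ := xOf_clUy hq1
  obtain ⟨xt, hxt, e, hle⟩ := loeper h0 h1 h2 hM (t := b) ⟨hb, by linarith⟩ hyb hy m0 m1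
  have hq : -gradY n c xt yb = a • q0 + b • q1 := by
    rw [e, e0, e1, smul_sub, ← sub_eq_iff_eq_add.2 hab.symm, sub_smul, one_smul]; abel
  have hx : xOf n c U yb (a • q0 + b • q1) = xt := by rw [← hq]; exact xOf_grad h1 hxt hyb
  refine ⟨⟨xt, hxt, hq⟩, ?_⟩
  unfold modCost
  rw [hx]
  have e5 : ∀ a b : ℝ, -(a - b) = -a + b := fun a b => by ring
  rw [e5, e5, e5]
  exact hle

lemma mod_conv (h0 : B0cond n c U V) (h1 : B1cond n c U V) (h2 : B2cond n c U V)
    (hM : MTW n c U V True) {yb y q0 q1 : Euc n} (hyb : yb ∈ closure V) (hy : y ∈ closure V)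
    (hq0 : q0 ∈ clUy n c U yb) (hq1 : q1 ∈ clUy n c U yb) {a b : ℝ} (ha : 0 ≤ a) (hb : 0 ≤ b)
    (hab : a + b = 1) :
      -modCost n c U yb (a • q0 + b • q1) y ≤
        a * (-modCost n c U yb q0 y) + b * (-modCost n c U yb q1 y) := by
  obtain ⟨m0, e0⟩ := xOf_clUy hq0
  obtain ⟨m1, e1⟩ := xOf_clUy hq1
  obtain ⟨xt, hxt, e, hle⟩ := loeper_conv h0 h1 h2 hM (t := b) ⟨hb, by linarith⟩ hyb hy m0 m1
  have ha' : 1 - b = a := by linarith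
  have hq : -gradY n c xt yb = a • q0 + b • q1 := by
    rw [e, e0, e1, smul_sub, ← ha', sub_smul, one_smul]; abel
  have hx : xOf n c U yb (a • q0 + b • q1) = xt := by rw [← hq]; exact xOf_grad h1 hxt hyb
  unfold modCost
  rw [hx]
  rw [ha'] at hle
  have e5 : ∀ a b : ℝ, -(a - b) = -a + b := fun a b => by ring
  rw [e5, e5, e5]
  exact hle

/-- the dual segment -/
noncomputable def ysg (n : ℕ) (c : Euc n → Euc n → ℝ) (V : Set (Euc n)) (x y0 y1 : Euc n)
    (s : ℝ) : Euc n :=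
  yOf n c V x (-gradX n c x y0 + s • (-gradX n c x y1 - -gradX n c x y0))

lemma ysg_loeper (h0 : B0cond n c U V) (h1 : B1cond n c U V) (h2 : B2cond n c U V)
    (hM : MTW n c U V False) {x y0 y1 : Euc n} (hx : x ∈ closure U) (hy0 : y0 ∈ closure V)
    (hy1 : y1 ∈ closure V) {s : ℝ} (hs : s ∈ Icc (0:ℝ) 1) {z : Euc n} (hz : z ∈ closure U) :
    ysg n c V x y0 y1 s ∈ closure V ∧
    -c z (ysg n c V x y0 y1 s) + c x (ysg n c V x y0 y1 s) ≤
      max (-c z y0 + c x y0) (-c z y1 + c x y1) := by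
  obtain ⟨yt, hyt, e, hle⟩ := loeper (B0flip h0) (B1flip h1) (B2flip h2) (MTWflip h0 hM) hs
    hx hz hy0 hy1
  have : ysg n c V x y0 y1 s = yt := by
    have h3 := xOf_grad (B1flip h1) hyt hx
    rw [e] at h3
    exact h3
  rw [this]
  exact ⟨hyt, hle⟩

lemma ysg_clos (h0 : B0cond n c U V) (h1 : B1cond n c U V) {x : Euc n} (hx : x ∈ closure U) :
    (fun y => -gradX n c x y) '' closure V = closure (Vxset n c V x) :=
  diffeo_closure h0.2.2.2.1 (h1.2 x hx)

lemma ysg_cont (h0 : B0cond n c U V) (h1 : B1cond n c U V) (h2 : B2cond n c U V)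
    {x y0 y1 : Euc n} (hx : x ∈ closure U) (hy0 : y0 ∈ closure V)
    (hy1 : y1 ∈ closure V) : ContinuousOn (ysg n c V x y0 y1) (Icc 0 1) := by
  have hcy : ContinuousOn (yOf n c V x) (closure (Vxset n c V x)) := by
    rw [← ysg_clos h0 h1 hx]; exact (h1.2 x hx).2.2.continuousOn
  refine hcy.comp (by fun_prop) fun s hs => ?_
  exact seg_mem (h2.2 x hx).closure (ysg_clos h0 h1 hx ▸ ⟨y0, hy0, rfl⟩)
    (ysg_clos h0 h1 hx ▸ ⟨y1, hy1, rfl⟩) hs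

lemma ysg_zero (h1 : B1cond n c U V) {x y0 y1 : Euc n} (hx : x ∈ closure U)
    (hy0 : y0 ∈ closure V) : ysg n c V x y0 y1 0 = y0 := by
  unfold ysg
  rw [zero_smul, add_zero]
  exact xOf_grad (B1flip h1) hy0 hx

lemma ysg_one (h1 : B1cond n c U V) {x y0 y1 : Euc n} (hx : x ∈ closure U)
    (hy1 : y1 ∈ closure V) : ysg n c V x y0 y1 1 = y1 := by
  unfold ysg
  rw [one_smul, add_sub_cancel]
  exact xOf_grad (B1flip h1) hy1 hx

lemma ysg_int (h0 : B0cond n c U V) (h1 : B1cond n c U V) (h2 : B2cond n c U V)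
    {x y0 y1 : Euc n} (hx : x ∈ U) (hy0 : y0 ∈ V)
    (hy1 : y1 ∈ closure V) {s : ℝ} (hs : s ∈ Ico (0:ℝ) 1) : ysg n c V x y0 y1 s ∈ V := by
  have hxc : x ∈ closure U := subset_closure hx
  have hopen : IsOpen (Vxset n c V x) := diffeo_open h0.2.2.1 (h1.2 x hxc)
  have hpc : -gradX n c x y1 ∈ closure (Vxset n c V x) := ysg_clos h0 h1 hxc ▸ ⟨y1, hy1, rfl⟩
  have hmem : -gradX n c x y0 + s • (-gradX n c x y1 - -gradX n c x y0) ∈ Vxset n c V x := by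
    have := (h2.2 x hxc).combo_interior_closure_mem_interior (x := -gradX n c x y0)
      (y := -gradX n c x y1) (a := 1 - s) (b := s)
      (by rw [hopen.interior_eq]; exact ⟨y0, hy0, rfl⟩) hpc (by linarith [hs.2]) hs.1 (by ring)
    rw [hopen.interior_eq] at this
    convert this using 1
    rw [smul_sub, sub_smul, one_smul]; abel
  exact (ychart h0 h1 hx hmem).1

/-- interior version of (d) -/
lemma part_d_int (h0 : B0cond n c U V) (h1 : B1cond n c U V) (h2 : B2cond n c U V)
    (hM : MTW n c U V False) (hu : CConvexOn n c (closure U) (closure V) u)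
    {yb qt y : Euc n} {Q : Set (Euc n)} (hyb : yb ∈ closure V) (hQc : IsCompact Q)
    (hQU : Q ⊆ Uyset n c U yb) (hqt : qt ∈ interior Q)
    (hbd : ∀ q ∈ frontier Q, modPot n c U yb u q = 0) (hy : y ∈ V)
    (hA : ∀ p ∈ frontier Q, -modCost n c U yb p y + modCost n c U yb qt y +
      modPot n c U yb u qt ≤ 0) :
    ∃ q ∈ Q, ∀ z ∈ closure U, u (xOf n c U yb q) + c (xOf n c U yb q) y ≤ u z + c z y := by
  have hV : V.Nonempty := ⟨y, hy⟩
  have hyc : y ∈ closure V := subset_closure hy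
  have hUcl : Uyset n c U yb ⊆ clUy n c U yb := image_mono subset_closure
  have hxm : MapsTo (xOf n c U yb) Q (closure U) := fun q hq => (xOf_clUy (hUcl (hQU hq))).1
  have hcont : ContinuousOn (fun q => u (xOf n c U yb q) + c (xOf n c U yb q) y) Q :=
    ((cont_u h0 hV hu).add (contX h0 hyc)).comp
      ((xOf_cont h1 hyb).mono (hQU.trans hUcl)) hxm
  have hqtQ := interior_subset hqt
  obtain ⟨p, hp, hmin⟩ := hQc.exists_isMinOn ⟨qt, hqtQ⟩ hcont
  have hmin' : ∀ q ∈ Q, u (xOf n c U yb p) + c (xOf n c U yb p) y ≤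
      u (xOf n c U yb q) + c (xOf n c U yb q) y := fun q hq => hmin hq
  have hex : ∃ p ∈ interior Q, ∀ q ∈ Q, u (xOf n c U yb p) + c (xOf n c U yb p) y ≤
      u (xOf n c U yb q) + c (xOf n c U yb q) y := by
    by_cases hpi : p ∈ interior Q
    · exact ⟨p, hpi, hmin'⟩
    · have hpf : p ∈ frontier Q := ⟨subset_closure hp, hpi⟩
      refine ⟨qt, hqt, fun q hq => ?_⟩
      have e1 := hA p hpf
      have e2 := hbd p hpf
      have e3 := hmin' q hq
      unfold modCost modPot at *
      linarith
  obtain ⟨p, hpi, hmin⟩ := hex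
  refine ⟨p, interior_subset hpi, ?_⟩
  obtain ⟨x, hx, hxe⟩ := hQU (interior_subset hpi)
  have hxp : xOf n c U yb p = x := by rw [← hxe]; exact xOf_grad h1 (subset_closure hx) hyb
  rw [hxp] at hmin ⊢
  refine local_global h0 h1 h2 hM hu hx hy ?_
  have hcg : ContinuousAt (fun x => -gradY n c x yb) x :=
    ((h1.1 yb hyb).2.1.continuousOn).continuousAt
      (mem_of_superset (h0.1.mem_nhds hx) subset_closure)
  have hev : ∀ᶠ z in 𝓝 x, -gradY n c z yb ∈ interior Q :=
    hcg.preimage_mem_nhds (isOpen_interior.mem_nhds (by simpa only [hxe] using hpi))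
  filter_upwards [hev, h0.1.mem_nhds hx] with z hz hzU
  have := hmin _ (interior_subset hz)
  rwa [xOf_grad h1 (subset_closure hzU) hyb] at this

lemma part_d (h0 : B0cond n c U V) (h1 : B1cond n c U V) (h2 : B2cond n c U V)
    (hM : MTW n c U V False) (hu : CConvexOn n c (closure U) (closure V) u)
    {yb qt y : Euc n} {Q : Set (Euc n)} (hyb : yb ∈ closure V) (hQc : IsCompact Q)
    (hQU : Q ⊆ Uyset n c U yb) (hqt : qt ∈ interior Q)
    (hbd : ∀ q ∈ frontier Q, modPot n c U yb u q = 0) (hneg : modPot n c U yb u qt < 0)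
    (hy : y ∈ closure V)
    (hA : ∀ p ∈ frontier Q, -modCost n c U yb p y + modCost n c U yb qt y +
      modPot n c U yb u qt ≤ 0) :
    ∃ q ∈ Q, ∀ z ∈ closure U, u (xOf n c U yb q) + c (xOf n c U yb q) y ≤ u z + c z y := by
  have hUcl : Uyset n c U yb ⊆ clUy n c U yb := image_mono subset_closure
  have hV : V.Nonempty := closure_nonempty_iff.1 ⟨_, hy⟩
  have hxm : MapsTo (xOf n c U yb) Q (closure U) := fun q hq => (xOf_clUy (hUcl (hQU hq))).1
  have hfQ : frontier Q ⊆ Q := hQc.isClosed.frontier_subset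
  obtain ⟨xt, hxt, hxe⟩ := hQU (interior_subset hqt)
  have hxt' : xOf n c U yb qt = xt := by rw [← hxe]; exact xOf_grad h1 (subset_closure hxt) hyb
  set k := modPot n c U yb u qt with hk
  -- an interior point near ybar
  obtain ⟨y2, hy2, hy2A⟩ : ∃ y2 ∈ V, ∀ p ∈ frontier Q,
      -modCost n c U yb p y2 + modCost n c U yb qt y2 + k ≤ 0 := by
    have huc := (cpt h0).uniformContinuousOn_of_continuous (cont_c h0)
    rw [Metric.uniformContinuousOn_iff] at huc
    obtain ⟨δ, hδ, h⟩ := huc (-k / 2) (by linarith)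
    obtain ⟨y2, hy2, hd⟩ := Metric.mem_closure_iff.1 hyb δ hδ
    refine ⟨y2, hy2, fun p hp => ?_⟩
    have key : ∀ x ∈ closure U, |c x yb - c x y2| < -k / 2 := by
      intro x hx
      have := h (x, yb) ⟨hx, hyb⟩ (x, y2) ⟨hx, subset_closure hy2⟩
        (by rw [Prod.dist_eq]; simpa using hd)
      simpa [Real.dist_eq, Function.uncurry] using this
    have a1 := abs_lt.1 (key _ (hxm (hfQ hp)))
    have a2 := abs_lt.1 (key _ (hxm (interior_subset hqt)))
    unfold modCost
    linarith [a1.1, a1.2, a2.1, a2.2]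
  have hy2c : y2 ∈ closure V := subset_closure hy2
  have hxtc : xt ∈ closure U := subset_closure hxt
  set s : ℕ → ℝ := fun k => 1 - 1 / ((k:ℝ) + 1) with hs
  have hsm : ∀ k, s k ∈ Ico (0:ℝ) 1 := by
    intro k
    have : (0:ℝ) < 1 / ((k:ℝ) + 1) := by positivity
    have h3 : 1 / ((k:ℝ) + 1) ≤ 1 := by
      rw [div_le_one (by positivity)]; linarith [(Nat.cast_nonneg k : (0:ℝ) ≤ k)]
    simp only [hs]
    constructor <;> linarith
  have hslim : Tendsto s atTop (𝓝 1) := by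
    have := (tendsto_one_div_add_atTop_nhds_zero_nat (𝕜 := ℝ)).const_sub 1
    rw [sub_zero] at this
    exact this
  set ys : ℕ → Euc n := fun k => ysg n c V xt y2 y (s k) with hys
  have hysV : ∀ k, ys k ∈ V := fun k => ysg_int h0 h1 h2 hxt hy2 hy (hsm k)
  have hyslim : Tendsto ys atTop (𝓝 y) := by
    have h3 := (ysg_cont h0 h1 h2 hxtc hy2c hy) 1 (by simp)
    rw [ContinuousWithinAt, ysg_one h1 hxtc hy] at h3
    exact h3.comp (tendsto_nhdsWithin_iff.2 ⟨hslim, Eventually.of_forall fun k =>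
      Ico_subset_Icc_self (hsm k)⟩)
  have hstep : ∀ k, ∃ q ∈ Q, ∀ z ∈ closure U,
      u (xOf n c U yb q) + c (xOf n c U yb q) (ys k) ≤ u z + c z (ys k) := by
    intro j
    refine part_d_int h0 h1 h2 hM hu hyb hQc hQU hqt hbd (hysV j) fun p hp => ?_
    have hl := (ysg_loeper h0 h1 h2 hM hxtc hy2c hy (Ico_subset_Icc_self (hsm j))
      (hxm (hfQ hp))).2
    have b1 := hA p hp
    have b2 := hy2A p hp
    change -c (xOf n c U yb p) (ys j) + c xt (ys j) ≤ _ at hl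
    rw [← hk]
    unfold modCost at *
    rw [hxt'] at *
    rcases le_max_iff.1 hl with h | h <;> linarith
  choose qs hqs hineq using hstep
  obtain ⟨q, hq, φ, hφ, lq⟩ := hQc.tendsto_subseq hqs
  refine ⟨q, hq, fun z hz => ?_⟩
  have lx : Tendsto (fun j => xOf n c U yb (qs (φ j))) atTop (𝓝[closure U] (xOf n c U yb q)) := by
    refine tendsto_nhdsWithin_iff.2 ⟨?_, Eventually.of_forall fun j => hxm (hqs _)⟩
    have h3 := ((xOf_cont h1 hyb).mono (hQU.trans hUcl)) q hq
    exact h3.tendsto.comp (tendsto_nhdsWithin_iff.2 ⟨lq, Eventually.of_forall fun j => hqs _⟩)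
  have ly : Tendsto (fun j => ys (φ j)) atTop (𝓝[closure V] y) :=
    tendsto_nhdsWithin_iff.2 ⟨hyslim.comp hφ.tendsto_atTop,
      Eventually.of_forall fun j => subset_closure (hysV _)⟩
  have l1 := ((cont_u h0 hV hu) _ (hxm hq)).tendsto.comp lx
  have l2 : Tendsto (fun j => c (xOf n c U yb (qs (φ j))) (ys (φ j))) atTop
      (𝓝 (c (xOf n c U yb q) y)) := by
    have h3 := (cont_c h0) (xOf n c U yb q, y) ⟨hxm hq, hy⟩
    rw [ContinuousWithinAt, nhdsWithin_prod_eq] at h3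
    exact h3.comp (lx.prodMk ly)
  have l3 := ((contY h0 hz) y hy).tendsto.comp ly
  exact le_of_tendsto_of_tendsto (l1.add l2) (l3.const_add (u z))
    (Eventually.of_forall fun j => hineq (φ j) z hz)

end final

end Helpers

/-- Lemma 6.5: basic properties of `c̃`-cones. -/
theorem cCone_basic_properties (n : ℕ) (c : Euc n → Euc n → ℝ) (U V : Set (Euc n))
    (u : Euc n → ℝ) (ybar qt : Euc n) (Q : Set (Euc n)) (h : Euc n → ℝ)
    (hB0 : B0cond n c U V) (hB1 : B1cond n c U V) (hB2 : B2cond n c U V)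
    (hB3 : B3cond n c U V)
    (hy : ybar ∈ closure V)
    (hu : CConvexOn n c (closure U) (closure V) u)
    (hQ : Q = {q ∈ clUy n c U ybar | modPot n c U ybar u q ≤ 0})
    (hqt : qt ∈ interior Q)
    (hbd : ∀ q ∈ frontier Q, modPot n c U ybar u q = 0)
    (hcl : closure Q ⊆ Uyset n c U ybar)
    (hneg : modPot n c U ybar u qt < 0)
    -- `h` is the `c̃`-cone generated by `q̃` and `Q` with height `-ũ(q̃) > 0`
    (hh : h = cConeFun n (modCost n c U ybar) (closure V) Q qt (modPot n c U ybar u qt)) :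
    -- (a) `h` has convex level sets; it is convex if (B4) holds
    (∀ r : ℝ, Convex ℝ {q ∈ clUy n c U ybar | h q ≤ r}) ∧
    (B4cond n c U V → ConvexOn ℝ (clUy n c U ybar) h) ∧
    -- (b) `h(q) ≥ h(q̃) = ũ(q̃)` on `Q`
    h qt = modPot n c U ybar u qt ∧
    (∀ q ∈ Q, h qt ≤ h q) ∧
    -- (c) `h = 0` on `∂Q`
    (∀ q ∈ frontier Q, h q = 0) ∧
    -- (d) `∂^{c̃}h(q̃) ⊆ ∂^{c̃}ũ(Q)`
    cSubdiffAt n (modCost n c U ybar) (clUy n c U ybar) (closure V) h qt ⊆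
      cSubdiffImg n (modCost n c U ybar) (clUy n c U ybar) (closure V)
        (modPot n c U ybar u) Q := by
  have hV : V.Nonempty := closure_nonempty_iff.1 ⟨_, hy⟩
  have hM := MTW_of_B3 hB0 hB1 hB3
  have hmp : ContinuousOn (modPot n c U ybar u) (clUy n c U ybar) := by
    have := ((cont_u hB0 hV hu).add (contX hB0 hy)).comp (xOf_cont hB1 hy)
      (fun q hq => (xOf_clUy hq).1)
    exact this
  have hQK : Q ⊆ clUy n c U ybar := by rw [hQ]; exact fun q hq => hq.1
  have hQc : IsCompact Q := by
    have hK := clUy_compact hB0 hB1 hy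
    refine hK.of_isClosed_subset ?_ hQK
    rw [hQ]
    exact hmp.preimage_isClosed_of_isClosed hK.isClosed isClosed_Iic
  have hQU : Q ⊆ Uyset n c U ybar := subset_closure.trans hcl
  have hfQ : frontier Q ⊆ Q := hQc.isClosed.frontier_subset
  have hqtK : qt ∈ clUy n c U ybar := hQK (interior_subset hqt)
  have hcty : ∀ q, modCost n c U ybar q ybar = 0 := fun q => by simp [modCost]
  set h0 := modPot n c U ybar u qt with hh0
  set ct := modCost n c U ybar with hct
  obtain ⟨B, hB⟩ := (cpt hB0).exists_bound_of_continuousOn (cont_c hB0)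
  have hBc : ∀ q ∈ clUy n c U ybar, ∀ y ∈ closure V, |ct q y| ≤ 2 * B := by
    intro q hq y hy'
    have e1 := hB (xOf n c U ybar q, y) ⟨(xOf_clUy hq).1, hy'⟩
    have e2 := hB (xOf n c U ybar q, ybar) ⟨(xOf_clUy hq).1, hy⟩
    rw [Real.norm_eq_abs, abs_le] at e1 e2
    simp only [Function.uncurry] at e1 e2
    rw [abs_le, hct]
    unfold modCost
    constructor <;> linarith [e1.1, e1.2, e2.1, e2.2]
  have hybA : ∀ p ∈ frontier Q, -ct p ybar + ct qt ybar + h0 ≤ 0 := fun p _ => by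
    rw [hcty, hcty]; linarith
  have hle : ∀ y ∈ closure V, (∀ p ∈ frontier Q, -ct p y + ct qt y + h0 ≤ 0) →
      ∀ q ∈ clUy n c U ybar, -ct q y + ct qt y + h0 ≤ h q := by
    intro y hyV hyA q hq
    rw [hh]
    refine le_csSup ⟨4 * B + h0, ?_⟩ ⟨y, hyV, rfl, hyA⟩
    rintro r ⟨w, hw, rfl, -⟩
    have e1 := abs_le.1 (hBc q hq w hw)
    have e2 := abs_le.1 (hBc qt hqtK w hw)
    linarith [e1.1, e2.2]
  have hle2 : ∀ q r, (∀ y ∈ closure V, (∀ p ∈ frontier Q, -ct p y + ct qt y + h0 ≤ 0) →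
      -ct q y + ct qt y + h0 ≤ r) → h q ≤ r := by
    intro q r H
    rw [hh]
    refine csSup_le ⟨_, ybar, hy, rfl, hybA⟩ ?_
    rintro r ⟨w, hw, rfl, hwA⟩
    exact H w hw hwA
  have hge : ∀ q ∈ clUy n c U ybar, h0 ≤ h q := fun q hq => by
    have := hle ybar hy hybA q hq
    rw [hcty, hcty] at this
    linarith
  have hqt0 : h qt = h0 := le_antisymm
    (hle2 _ _ fun y _ _ => by linarith) (hge _ hqtK)
  have hc0 : ∀ q ∈ frontier Q, h q = 0 := by
    intro q hq
    refine le_antisymm (hle2 _ _ fun y _ hA => hA q hq) ?_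
    have hqK := hQK (hfQ hq)
    obtain ⟨hxU, -⟩ := xOf_clUy hqK
    set x := xOf n c U ybar q with hx
    obtain ⟨y0, hy0, hs0⟩ := supp_exists hB0 hV hu hxU
    obtain ⟨hxtU, -⟩ := xOf_clUy hqtK
    set xt := xOf n c U ybar qt with hxt
    have hu0 : u x + c x ybar = 0 := hbd q hq
    have hut : h0 = u xt + c xt ybar := rfl
    have hyc := ysg_cont hB0 hB1 hB2 hxU hy hy0
    have hymaps : MapsTo (ysg n c V x ybar y0) (Icc 0 1) (closure V) := fun s hs =>
      (ysg_loeper hB0 hB1 hB2 hM hxU hy hy0 hs hxU).1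
    have hMc : ContinuousOn (fun s => -(c xt (ysg n c V x ybar y0 s) - c xt ybar) +
        (c x (ysg n c V x ybar y0 s) - c x ybar)) (Icc 0 1) := by
      have a1 := (contY hB0 hxtU).comp hyc hymaps
      have a2 := (contY hB0 hxU).comp hyc hymaps
      exact (a1.sub continuousOn_const).neg.add (a2.sub continuousOn_const)
    have hivt := intermediate_value_Icc' (zero_le_one (α := ℝ)) hMc
    obtain ⟨s, hs, hse⟩ := hivt (show h0 ∈ Icc _ _ by
      constructor
      · rw [ysg_one hB1 hxU hy0]
        have := hs0 xt hxtU
        linarith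
      · rw [ysg_zero hB1 hxU hy]
        linarith)
    simp only at hse
    have hcq : ∀ y, ct q y = c x y - c x ybar := fun y => rfl
    have hcqt : ∀ y, ct qt y = c xt y - c xt ybar := fun y => rfl
    have hfin := hle (ysg n c V x ybar y0 s) (hymaps hs) (by
      intro p hp
      obtain ⟨hzU, -⟩ := xOf_clUy (hQK (hfQ hp))
      have hcp : ∀ y, ct p y = c (xOf n c U ybar p) y - c (xOf n c U ybar p) ybar := fun y => rfl
      have hup : u (xOf n c U ybar p) + c (xOf n c U ybar p) ybar = 0 := hbd p hp
      have e1 := (ysg_loeper hB0 hB1 hB2 hM hxU hy hy0 hs hzU).2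
      have e2 := hs0 _ hzU
      rw [hcp, hcqt, ← hse]
      have e3 := max_le (c := -c (xOf n c U ybar p) ybar + c x ybar) le_rfl
        (show -c (xOf n c U ybar p) y0 + c x y0 ≤ _ by linarith)
      linarith) q hqK
    rw [hcq, hcqt, ← hse] at hfin
    linarith
  refine ⟨?_, ?_, hqt0, ?_, hc0, ?_⟩
  · intro r q0 hq0 q1 hq1 a b ha hb hab
    refine ⟨(mod_loeper hB0 hB1 hB2 hM hy hy hq0.1 hq1.1 ha hb hab).1, hle2 _ _ ?_⟩
    intro y hyV hyA
    have e := (mod_loeper hB0 hB1 hB2 hM hy hyV hq0.1 hq1.1 ha hb hab).2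
    have e0 := (hle y hyV hyA q0 hq0.1).trans hq0.2
    have e1 := (hle y hyV hyA q1 hq1.1).trans hq1.2
    have e3 : max (-ct q0 y) (-ct q1 y) ≤ r - ct qt y - h0 :=
      max_le (by linarith) (by linarith)
    have := e.trans e3
    linarith
  · intro hB4
    have hM4 := MTW_of_B4 hB0 hB1 hB4
    refine ⟨?_, ?_⟩
    · intro q0 hq0 q1 hq1 a b ha hb hab
      exact (mod_loeper hB0 hB1 hB2 hM hy hy hq0 hq1 ha hb hab).1
    · intro q0 hq0 q1 hq1 a b ha hb hab
      refine hle2 _ _ ?_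
      intro y hyV hyA
      have e := mod_conv hB0 hB1 hB2 hM4 hy hyV hq0 hq1 ha hb hab
      have e0 := mul_le_mul_of_nonneg_left (hle y hyV hyA q0 hq0) ha
      have e1 := mul_le_mul_of_nonneg_left (hle y hyV hyA q1 hq1) hb
      have e2 : ct qt y + h0 = a * (ct qt y + h0) + b * (ct qt y + h0) := by
        rw [← add_mul, hab, one_mul]
      rw [smul_eq_mul, smul_eq_mul]
      linarith
  · intro q hq
    rw [hqt0]
    exact hge q (hQK hq)
  · rintro y ⟨-, hyV, heq⟩
    simp only at hyV heq
    have hsup : ∀ q ∈ clUy n c U ybar, -ct q y - h q ≤ cStarT n ct (clUy n c U ybar) h y := by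
      intro q hq
      refine le_csSup ⟨2 * B - h0, ?_⟩ ⟨q, hq, rfl⟩
      rintro _ ⟨z, hz, rfl⟩
      have e1 := abs_le.1 (hBc z hz y hyV)
      have e2 := hge z hz
      simp only
      linarith [e1.1]
    obtain ⟨qs, hqs, hmin⟩ := part_d hB0 hB1 hB2 hM hu hy hQc hQU hqt hbd hneg hyV (by
      intro p hp
      have e1 := hsup p (hQK (hfQ hp))
      rw [hc0 p hp] at e1
      rw [hqt0] at heq
      linarith)
    refine mem_iUnion₂.2 ⟨qs, hqs, hQK hqs, hyV, ?_⟩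
    have hG : IsGreatest ((fun q => -ct q y - modPot n c U ybar u q) '' clUy n c U ybar)
        (-ct qs y - modPot n c U ybar u qs) := by
      refine ⟨⟨qs, hQK hqs, rfl⟩, ?_⟩
      rintro _ ⟨z, hz, rfl⟩
      have e1 := hmin _ (xOf_clUy hz).1
      simp only [hct, modCost, modPot]
      linarith
    have e := hG.csSup_eq
    simp only [cStarT]
    rw [e]
    ring
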